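/- arXiv:1709.08877 — 11 statements merged into one kernel-verified Lean document; each statement's English description precedes it below -/
import Mathlib

section
/- Let (V,g,J) be a pseudo-hermitian vector space, let A be a hermitian endomorphism of V, and let Θ be a real polynomial with Θ(A) = 0 (evaluation of Θ at A). Then the operator 𝖱_{Θ,A} satisfies the integrability condition of a symmetric space: for all X, Y ∈ u(g,J) one has [𝖱_{Θ,A}(X), 𝖱_{Θ,A}(Y)] = 𝖱_{Θ,A}([𝖱_{Θ,A}(X), Y]), where [·,·] denotes the commutator of endomorphisms of V. -/
open Finset Polynomial

noncomputable section

/-- The Lie algebra `u(g,J)` of skew-hermitian endomorphisms: `g(Xx,y) = -g(x,Xy)`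
and `X ∘ J = J ∘ X`. -/
def SkewHerm {V : Type*} [AddCommGroup V] [Module ℝ V]
    (g : V →ₗ[ℝ] V →ₗ[ℝ] ℝ) (J X : Module.End ℝ V) : Prop :=
  (∀ x y : V, g (X x) y = - g x (X y)) ∧ X * J = J * X

/-- The operator `𝖱_{q,A}` on endomorphisms:
`𝖱_{q,A}(X) = Σ_{k=1}^N a_k Σ_{r+s=k−1} (A^s X A^r − (1/2)·tr(J A^s X)·J A^r)`. -/
def Rop {V : Type*} [AddCommGroup V] [Module ℝ V]
    (J : Module.End ℝ V) (q : Polynomial ℝ) (A X : Module.End ℝ V) : Module.End ℝ V :=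
  ∑ k ∈ Finset.range (q.natDegree + 1), q.coeff k •
    ∑ r ∈ Finset.range k,
      (A ^ (k - 1 - r) * X * A ^ r
        - ((1 : ℝ) / 2 * LinearMap.trace ℝ V (J * A ^ (k - 1 - r) * X)) • (J * A ^ r))

/-- `A` commutes with `Σ A^s X A^r` up to the telescoping defect `A^k X - X A^k`. -/
theorem mul_sum_sub_sum_mul {R : Type*} [Ring R] (A X : R) (k : ℕ) :
    A * ∑ r ∈ Finset.range k, A ^ (k - 1 - r) * X * A ^ r
      - (∑ r ∈ Finset.range k, A ^ (k - 1 - r) * X * A ^ r) * A = A ^ k * X - X * A ^ k := by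
  rw [Finset.mul_sum, Finset.sum_mul, ← Finset.sum_sub_distrib]
  trans ∑ r ∈ Finset.range k, (A ^ (k - r) * X * A ^ r - A ^ (k - (r + 1)) * X * A ^ (r + 1))
  · refine Finset.sum_congr rfl fun r hr => ?_
    have hr' := Finset.mem_range.mp hr
    rw [show k - r = k - 1 - r + 1 by omega, show k - (r + 1) = k - 1 - r by omega,
      pow_succ' A (k - 1 - r), pow_succ A r]
    simp only [mul_assoc]
  · rw [Finset.sum_range_sub' (fun r => A ^ (k - r) * X * A ^ r) k]
    simp

section Rop

variable {V : Type*} [AddCommGroup V] [Module ℝ V] {J A : Module.End ℝ V}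

theorem commute_Rop_of_aeval_eq_zero (hAJ : Commute A J) {q : Polynomial ℝ}
    (hq : Polynomial.aeval A q = 0) (X : Module.End ℝ V) : Commute A (Rop J q A X) := by
  have hterm : ∀ k : ℕ, A * (∑ r ∈ Finset.range k, (A ^ (k - 1 - r) * X * A ^ r
        - ((1 : ℝ) / 2 * LinearMap.trace ℝ V (J * A ^ (k - 1 - r) * X)) • (J * A ^ r)))
      - (∑ r ∈ Finset.range k, (A ^ (k - 1 - r) * X * A ^ r
        - ((1 : ℝ) / 2 * LinearMap.trace ℝ V (J * A ^ (k - 1 - r) * X)) • (J * A ^ r))) * A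
      = A ^ k * X - X * A ^ k := by
    intro k
    have hJ : Commute A (∑ r ∈ Finset.range k,
        ((1 : ℝ) / 2 * LinearMap.trace ℝ V (J * A ^ (k - 1 - r) * X)) • (J * A ^ r)) :=
      Commute.sum_right _ _ _ fun r _ =>
        (hAJ.mul_right ((Commute.refl A).pow_right r)).smul_right _
    rw [Finset.sum_sub_distrib, mul_sub, sub_mul, hJ.eq, sub_sub_sub_cancel_right,
      mul_sum_sub_sum_mul]
  rw [commute_iff_eq, ← sub_eq_zero, Rop, Finset.mul_sum, Finset.sum_mul,
    ← Finset.sum_sub_distrib]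
  have hsum : ∑ k ∈ Finset.range (q.natDegree + 1), q.coeff k • (A ^ k * X - X * A ^ k)
      = Polynomial.aeval A q * X - X * Polynomial.aeval A q := by
    simp only [Polynomial.aeval_eq_sum_range, Finset.sum_mul, Finset.mul_sum, smul_mul_assoc,
      mul_smul_comm, smul_sub, Finset.sum_sub_distrib]
  simp only [mul_smul_comm, smul_mul_assoc, ← smul_sub, hterm]
  rw [hsum, hq, zero_mul, mul_zero, sub_zero]

theorem commute_Rop (hAJ : Commute A J) (q : Polynomial ℝ) {X : Module.End ℝ V}
    (hX : Commute X J) : Commute (Rop J q A X) J :=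
  Commute.sum_left _ _ _ fun _ _ => Commute.smul_left
    (Commute.sum_left _ _ _ fun r _ =>
      (((hAJ.pow_left _).mul_left hX).mul_left (hAJ.pow_left r)).sub_left
        (((Commute.refl J).mul_left (hAJ.pow_left r)).smul_left _)) _

/-- `𝖱_{q,A}` is equivariant under the centralizer of `A` and `J`. -/
theorem Rop_commutator {P : Module.End ℝ V} (hPA : Commute P A) (hPJ : Commute P J)
    (q : Polynomial ℝ) (Y : Module.End ℝ V) :
    Rop J q A (P * Y - Y * P) = P * Rop J q A Y - Rop J q A Y * P := by
  simp only [Rop, Finset.mul_sum, Finset.sum_mul, ← Finset.sum_sub_distrib, mul_smul_comm,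
    smul_mul_assoc, ← smul_sub]
  refine Finset.sum_congr rfl fun k _ => congrArg _ (Finset.sum_congr rfl fun r _ => ?_)
  have hs := hPA.pow_right (k - 1 - r)
  have hr := hPA.pow_right r
  have hJr := hPJ.mul_right hr
  have htr : LinearMap.trace ℝ V (J * A ^ (k - 1 - r) * (P * Y - Y * P)) = 0 := by
    rw [mul_sub, ← mul_assoc, ← (hPJ.mul_right hs).eq, mul_assoc P, ← mul_assoc _ Y P,
      map_sub, LinearMap.trace_mul_comm, sub_self]
  have hmain : A ^ (k - 1 - r) * (P * Y - Y * P) * A ^ r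
      = P * (A ^ (k - 1 - r) * Y * A ^ r) - A ^ (k - 1 - r) * Y * A ^ r * P := by
    rw [mul_sub, sub_mul, ← mul_assoc _ P Y, ← hs.eq, mul_assoc _ _ P, ← hr.eq]
    simp only [mul_assoc]
  rw [htr, mul_zero, zero_smul, sub_zero, hmain, mul_sub, sub_mul, mul_smul_comm,
    smul_mul_assoc, hJr.eq, sub_sub_sub_cancel_right]

end Rop

/-- If `Θ(A) = 0` then `𝖱_{Θ,A}` satisfies the integrability condition of a symmetric
space: `[𝖱_{Θ,A}(X), 𝖱_{Θ,A}(Y)] = 𝖱_{Θ,A}([𝖱_{Θ,A}(X), Y])` for all `X, Y ∈ u(g,J)`. -/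
theorem stmt0
    (V : Type*) [AddCommGroup V] [Module ℝ V] [FiniteDimensional ℝ V]
    (g : V →ₗ[ℝ] V →ₗ[ℝ] ℝ)
    (hgsymm : ∀ x y : V, g x y = g y x)
    (hgnd : ∀ x : V, (∀ y : V, g x y = 0) → x = 0)
    (J : Module.End ℝ V)
    (hJ2 : J * J = -1)
    (hJg : ∀ x y : V, g (J x) (J y) = g x y)
    (A : Module.End ℝ V)
    (hAg : ∀ x y : V, g (A x) y = g x (A y))
    (hAJ : A * J = J * A)
    (Θ : Polynomial ℝ)
    (hΘA : Polynomial.aeval A Θ = 0) :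
    ∀ X Y : Module.End ℝ V, SkewHerm g J X → SkewHerm g J Y →
      Rop J Θ A X * Rop J Θ A Y - Rop J Θ A Y * Rop J Θ A X
        = Rop J Θ A (Rop J Θ A X * Y - Y * Rop J Θ A X) := by
  intro X Y hX _
  exact (Rop_commutator (commute_Rop_of_aeval_eq_zero hAJ hΘA X).symm
    (commute_Rop hAJ Θ hX.2) Θ Y).symm
end
end

section
/- Let (V,g,J) be a pseudo-hermitian vector space, let A be a hermitian endomorphism of V, and let Θ be a real polynomial with Θ(A) = 0. Then 𝖱_{Θ,A}(X) commutes with A for every X ∈ u(g,J), i.e. [𝖱_{Θ,A}(X), A] = 0 for all X ∈ u(g,J). -/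
open Finset Polynomial

noncomputable section

/-- The commutator of `𝖱_{q,A}(X)` with `A` is `[X, q(A)]`: the trace terms cancel since `A` and
`J` commute, and the remaining sums telescope. -/
theorem Rop_mul_sub_mul_Rop {V : Type*} [AddCommGroup V] [Module ℝ V]
    {J A : Module.End ℝ V} (hAJ : A * J = J * A) (q : Polynomial ℝ) (X : Module.End ℝ V) :
    Rop J q A X * A - A * Rop J q A X = X * aeval A q - aeval A q * X := by
  rw [aeval_eq_sum_range, Rop, sum_mul, mul_sum, mul_sum, sum_mul, ← sum_sub_distrib,
    ← sum_sub_distrib]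
  refine sum_congr rfl fun k _ => ?_
  simp only [smul_mul_assoc, mul_smul_comm, ← smul_sub]
  congr 1
  rw [sum_mul, mul_sum, ← sum_sub_distrib]
  have telescope := sum_range_sub (fun r => A ^ (k - r) * X * A ^ r) k
  simp only [Nat.sub_self, pow_zero, one_mul, Nat.sub_zero, mul_one] at telescope
  rw [← telescope]
  refine sum_congr rfl fun r hr => ?_
  have hrk : r < k := mem_range.mp hr
  have comm : A * (J * A ^ r) = J * A ^ r * A := by
    rw [← mul_assoc, hAJ, mul_assoc, mul_assoc, ← pow_succ', ← pow_succ]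
  have hs : A ^ (k - r) = A * A ^ (k - 1 - r) := by
    rw [← pow_succ']
    congr 1
    omega
  have hs' : k - (r + 1) = k - 1 - r := by omega
  rw [sub_mul, mul_sub, smul_mul_assoc, mul_smul_comm, comm, sub_sub_sub_cancel_right, hs, hs',
    pow_succ]
  simp only [mul_assoc]

/-- If `Θ(A) = 0` then `𝖱_{Θ,A}(X)` commutes with `A` for every `X ∈ u(g,J)`. -/
theorem stmt1
    (V : Type*) [AddCommGroup V] [Module ℝ V] [FiniteDimensional ℝ V]
    (g : V →ₗ[ℝ] V →ₗ[ℝ] ℝ)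
    (hgsymm : ∀ x y : V, g x y = g y x)
    (hgnd : ∀ x : V, (∀ y : V, g x y = 0) → x = 0)
    (J : Module.End ℝ V)
    (hJ2 : J * J = -1)
    (hJg : ∀ x y : V, g (J x) (J y) = g x y)
    (A : Module.End ℝ V)
    (hAg : ∀ x y : V, g (A x) y = g x (A y))
    (hAJ : A * J = J * A)
    (Θ : Polynomial ℝ)
    (hΘA : Polynomial.aeval A Θ = 0) :
    ∀ X : Module.End ℝ V, SkewHerm g J X →
      Rop J Θ A X * A - A * Rop J Θ A X = 0 := by
  intro X _
  rw [Rop_mul_sub_mul_Rop hAJ, hΘA, mul_zero, zero_mul, sub_zero]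
end
end

section
/- Let (V,g,J) be a pseudo-hermitian vector space, let A be a hermitian endomorphism of V, and let q be a real polynomial. If [𝖱_{q,A}(X), A] = 0 for every X ∈ u(g,J), then q(A) is a real scalar multiple of the identity, i.e. there exists c ∈ ℝ with q(A) = c·id. -/
open Finset Polynomial

noncomputable section

/-- A polynomial in a `g`-self-adjoint endomorphism is `g`-self-adjoint. -/
theorem aeval_selfAdjoint {V : Type*} [AddCommGroup V] [Module ℝ V]
    {g : V →ₗ[ℝ] V →ₗ[ℝ] ℝ} {A : Module.End ℝ V}
    (hAg : ∀ x y : V, g (A x) y = g x (A y)) (q : Polynomial ℝ) (x y : V) :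
    g (aeval A q x) y = g x (aeval A q y) := by
  induction q using Polynomial.induction_on generalizing x y with
  | C a => simp [Module.algebraMap_end_apply]
  | add p q hp hq => simp [hp, hq]
  | monomial n a h =>
    have hcomm : Commute (aeval A (C a * X ^ n)) A := by
      simpa only [aeval_X] using (Commute.all (C a * X ^ n) (X : ℝ[X])).map (aeval A)
    rw [pow_succ, ← mul_assoc, map_mul, aeval_X, Module.End.mul_apply, h, hAg,
      ← Module.End.mul_apply, hcomm.eq]

/-- The skew-hermitian endomorphism `x ↦ g(u,x) Ju - g(Ju,x) u`. -/
def skewHermOfVector {V : Type*} [AddCommGroup V] [Module ℝ V]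
    (g : V →ₗ[ℝ] V →ₗ[ℝ] ℝ) (J : Module.End ℝ V) (u : V) : Module.End ℝ V :=
  (g u).smulRight (J u) - (g (J u)).smulRight u

theorem skewHermOfVector_apply {V : Type*} [AddCommGroup V] [Module ℝ V]
    (g : V →ₗ[ℝ] V →ₗ[ℝ] ℝ) (J : Module.End ℝ V) (u x : V) :
    skewHermOfVector g J u x = g u x • J u - g (J u) x • u := rfl

section

variable {V : Type*} [AddCommGroup V] [Module ℝ V] {g : V →ₗ[ℝ] V →ₗ[ℝ] ℝ} {J : Module.End ℝ V}

theorem J_J_apply (hJ2 : J * J = -1) (x : V) : J (J x) = -x := by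
  simpa using LinearMap.congr_fun hJ2 x

theorem J_skewAdjoint (hJ2 : J * J = -1) (hJg : ∀ x y : V, g (J x) (J y) = g x y) (x y : V) :
    g x (J y) = -g (J x) y := by
  rw [← hJg x (J y), J_J_apply hJ2, map_neg]

theorem skewHerm_skewHermOfVector (hgsymm : ∀ x y : V, g x y = g y x) (hJ2 : J * J = -1)
    (hJg : ∀ x y : V, g (J x) (J y) = g x y) (u : V) :
    SkewHerm g J (skewHermOfVector g J u) := by
  refine ⟨fun x y => ?_, LinearMap.ext fun x => ?_⟩
  · simp only [skewHermOfVector_apply, map_sub, map_smul, LinearMap.sub_apply,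
      LinearMap.smul_apply, smul_eq_mul, hgsymm x]
    ring
  · simp only [Module.End.mul_apply, skewHermOfVector_apply, map_sub, map_smul,
      J_J_apply hJ2, J_skewAdjoint hJ2 hJg, map_neg, LinearMap.neg_apply]
    module

/-- A hermitian endomorphism commuting with all skew-hermitian ones has every vector as an
eigenvector. -/
theorem exists_apply_eq_smul_of_commute_skewHerm
    (hgsymm : ∀ x y : V, g x y = g y x) (hgnd : ∀ x : V, (∀ y : V, g x y = 0) → x = 0)
    (hJ2 : J * J = -1) (hJg : ∀ x y : V, g (J x) (J y) = g x y) {B : Module.End ℝ V}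
    (hBg : ∀ x y : V, g (B x) y = g x (B y)) (hBJ : B * J = J * B)
    (hB : ∀ X : Module.End ℝ V, SkewHerm g J X → X * B = B * X) (u : V) :
    ∃ a : ℝ, B u = a • u := by
  have hBJ' (x : V) : B (J x) = J (B x) := LinearMap.congr_fun hBJ x
  by_cases hu : u = 0
  · exact ⟨0, by simp [hu]⟩
  obtain ⟨y, hy⟩ : ∃ y, g u y ≠ 0 := by
    by_contra! h
    exact hu (hgnd u h)
  have key : g (B u) y • J u - g (J (B u)) y • u = g u y • J (B u) - g (J u) y • B u := by
    have h := LinearMap.congr_fun (hB _ (skewHerm_skewHermOfVector hgsymm hJ2 hJg u)) y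
    simpa only [Module.End.mul_apply, skewHermOfVector_apply, ← hBg, hBJ', map_sub,
      map_smul] using h
  have hn : g u y ^ 2 + g (J u) y ^ 2 ≠ 0 := by positivity
  have keyJ := congrArg J key
  simp only [map_sub, map_smul, J_J_apply hJ2] at keyJ
  obtain ⟨a, b, hab⟩ : ∃ a b : ℝ, B u = a • u + b • J u := by
    generalize g (B u) y = α at key keyJ
    generalize g (J (B u)) y = β at key keyJ
    refine ⟨(g u y ^ 2 + g (J u) y ^ 2)⁻¹ * (g u y * α + g (J u) y * β),
      (g u y ^ 2 + g (J u) y ^ 2)⁻¹ * (g u y * β - g (J u) y * α), ?_⟩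
    rw [mul_smul, mul_smul, ← smul_add, eq_inv_smul_iff₀ hn]
    linear_combination (norm := module) (g (J u) y) • key + (g u y) • keyJ
  have hJab : J (B u) = a • J u - b • u := by
    rw [hab, map_add, map_smul, map_smul, J_J_apply hJ2]
    module
  rw [hJab, hab] at key
  simp only [map_add, map_sub, map_smul, LinearMap.add_apply, LinearMap.sub_apply,
    LinearMap.smul_apply, smul_eq_mul] at key
  have hJkey := congrArg J key
  simp only [map_add, map_sub, map_smul, J_J_apply hJ2] at hJkey
  have hb : (2 * b * (g u y ^ 2 + g (J u) y ^ 2)) • u = 0 := by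
    linear_combination (norm := module) (g u y) • key - (g (J u) y) • hJkey
  have hb0 : b = 0 := by
    rcases smul_eq_zero.mp hb with h | h
    · simpa [hn] using h
    · exact absurd h hu
  exact ⟨a, by simpa [hb0] using hab⟩

end

/-- If `[𝖱_{q,A}(X), A] = 0` for every `X ∈ u(g,J)`, then `q(A)` is a real scalar
multiple of the identity. -/
theorem stmt2
    (V : Type*) [AddCommGroup V] [Module ℝ V] [FiniteDimensional ℝ V]
    (g : V →ₗ[ℝ] V →ₗ[ℝ] ℝ)
    (hgsymm : ∀ x y : V, g x y = g y x)
    (hgnd : ∀ x : V, (∀ y : V, g x y = 0) → x = 0)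
    (J : Module.End ℝ V)
    (hJ2 : J * J = -1)
    (hJg : ∀ x y : V, g (J x) (J y) = g x y)
    (A : Module.End ℝ V)
    (hAg : ∀ x y : V, g (A x) y = g x (A y))
    (hAJ : A * J = J * A)
    (q : Polynomial ℝ)
    (hcomm : ∀ X : Module.End ℝ V, SkewHerm g J X →
      Rop J q A X * A - A * Rop J q A X = 0) :
    ∃ c : ℝ, Polynomial.aeval A q = c • (1 : Module.End ℝ V) := by
  have hBJ : aeval A q * J = J * aeval A q :=
    (Polynomial.aeval_eq_sum_range (p := q) A ▸
      Commute.sum_left _ _ _ fun i _ => ((show Commute A J from hAJ).pow_left i).smul_left _)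
  have hB : ∀ X : Module.End ℝ V, SkewHerm g J X → X * aeval A q = aeval A q * X := fun X hX =>
    sub_eq_zero.mp ((Rop_mul_sub_mul_Rop hAJ q X).symm.trans (hcomm X hX))
  refine LinearMap.exists_eq_smul_id_of_forall_notLinearIndependent fun v hv => ?_
  obtain ⟨a, ha⟩ := exists_apply_eq_smul_of_commute_skewHerm hgsymm hgnd hJ2 hJg
    (aeval_selfAdjoint hAg q) hBJ hB v
  rw [LinearIndependent.pair_iff] at hv
  simpa using (hv a (-1) (by rw [ha]; module)).2
end
end

section
/- Let (V,g,J) be a pseudo-hermitian vector space and let A, B be hermitian endomorphisms of V. Suppose 𝖱 is a map from u(g,J) to u(g,J) (linearity is not needed for the conclusion) such that [𝖱(X), A] = [X, B] for all X ∈ u(g,J). Then B is a real polynomial in A: there exists a polynomial q with real coefficients such that B = q(A). -/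
open Finset Polynomial

noncomputable section

namespace Module.End

variable {K V : Type*} [Field K] [AddCommGroup V] [Module K V] [FiniteDimensional K V]

theorem exists_maximal_vector (A : Module.End K V) :
    ∃ v : V, ∀ p : K[X], aeval A p v = 0 → aeval A p = 0 := by
  obtain ⟨x, hx⟩ := Module.exists_ker_toSpanSingleton_eq_annihilator K[X] (Module.AEval' A)
  refine ⟨(Module.AEval'.of A).symm x, fun p hp => ?_⟩
  have hmem : p ∈ LinearMap.ker (LinearMap.toSpanSingleton K[X] (Module.AEval' A) x) := by
    rw [LinearMap.mem_ker, LinearMap.toSpanSingleton_apply]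
    apply (Module.AEval'.of A).symm.injective
    rw [map_zero, Module.AEval.of_symm_smul]
    exact hp
  rwa [hx, Module.AEval.annihilator_eq_ker_aeval, RingHom.mem_ker] at hmem

theorem exists_dual_eq_coeff {A : Module.End K V} {v : V}
    (hv : ∀ p : K[X], aeval A p v = 0 → aeval A p = 0) (k : ℕ) :
    ∃ f : V →ₗ[K] K, ∀ p : K[X], p.degree < (minpoly K A).degree →
      f (aeval A p v) = p.coeff k := by
  let d := (minpoly K A).natDegree
  have hdeg : (minpoly K A).degree = d :=
    degree_eq_natDegree (minpoly.ne_zero (Algebra.IsIntegral.isIntegral A))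
  let L : degreeLT K d →ₗ[K] V :=
    (LinearMap.applyₗ v ∘ₗ (aeval A).toLinearMap) ∘ₗ (degreeLT K d).subtype
  have hL : LinearMap.ker L = ⊥ := by
    rw [LinearMap.ker_eq_bot']
    rintro ⟨p, hp⟩ h
    rw [mem_degreeLT, ← hdeg] at hp
    have h0 : aeval A p = 0 := hv p h
    ext1
    by_contra hne
    exact absurd (minpoly.degree_le_of_ne_zero K A hne h0) (not_le.mpr hp)
  obtain ⟨r, hr⟩ := L.exists_leftInverse_of_injective hL
  refine ⟨lcoeff K k ∘ₗ (degreeLT K d).subtype ∘ₗ r, fun p hp => ?_⟩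
  have hp' : p ∈ degreeLT K d := by rwa [mem_degreeLT, ← hdeg]
  have := LinearMap.congr_fun hr ⟨p, hp'⟩
  have h2 : r (aeval A p v) = ⟨p, hp'⟩ := this
  simp [h2]

theorem coeff_iterate_divX (p : K[X]) (j n : ℕ) :
    (divX^[j] p).coeff n = p.coeff (n + j) := by
  induction j generalizing n with
  | zero => rfl
  | succ j ih => rw [Function.iterate_succ_apply', coeff_divX, ih]; congr 1; ring

/-- If `v` has the same annihilator as `V` in `K[A]`, every vector `w` is the image of `v` under
an endomorphism commuting with `A` whose range is contained in the cyclic subspace of `w`. -/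
theorem exists_commute_apply_eq {A : Module.End K V} {v : V}
    (hv : ∀ p : K[X], aeval A p v = 0 → aeval A p = 0) (w : V) :
    ∃ C : Module.End K V, Commute A C ∧ C v = w ∧ ∀ u, ∃ p : K[X], C u = aeval A p w := by
  obtain _ | _ := subsingleton_or_nontrivial V
  · exact ⟨0, .zero_right A, Subsingleton.elim _ _, fun _ => ⟨0, Subsingleton.elim _ _⟩⟩
  have hA : IsIntegral K A := Algebra.IsIntegral.isIntegral A
  set m := minpoly K A with hm
  set d := m.natDegree with hd
  have hdpos : 0 < d := minpoly.natDegree_pos hA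
  have hmonic : m.Monic := minpoly.monic hA
  obtain ⟨f, hf⟩ := exists_dual_eq_coeff hv (d - 1)
  let C : Module.End K V := ∑ j ∈ range d,
    (f ∘ₗ aeval A (divX^[j + 1] m)).smulRight ((A ^ j) w)
  have hC : ∀ u, C u = ∑ j ∈ range d, f (aeval A (divX^[j + 1] m) u) • (A ^ j) w := by
    intro u; simp [C, LinearMap.sum_apply]
  refine ⟨C, ?_, ?_, fun u => ?_⟩
  · refine LinearMap.ext fun u => ?_
    have hstep : ∀ j, aeval A (divX^[j + 1] m) (A u) =
        aeval A (divX^[j] m) u - m.coeff j • u := by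
      intro j
      have h := congrArg (fun q => aeval A q u) (divX_mul_X_add (divX^[j] m))
      simp only [map_add, map_mul, aeval_X, aeval_C, coeff_iterate_divX, zero_add,
        LinearMap.add_apply, Module.End.mul_apply, Module.algebraMap_end_apply] at h
      rw [Function.iterate_succ_apply', ← h, add_sub_cancel_right]
    have htop : divX^[d] m = 1 := by
      ext n
      rw [coeff_iterate_divX, coeff_one]
      split_ifs with h
      · rw [h, zero_add]; exact hmonic.coeff_natDegree
      · exact coeff_eq_zero_of_natDegree_lt (by omega)
    have hzero : ∑ j ∈ range (d + 1), m.coeff j • (A ^ j) w = 0 := by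
      have h := congrArg (fun T : Module.End K V => T w) (minpoly.aeval K A)
      simpa [aeval_eq_sum_range, LinearMap.sum_apply] using h
    rw [sum_range_succ, hmonic.coeff_natDegree, one_smul] at hzero
    have htel := Finset.sum_range_sub (fun j => f (aeval A (divX^[j] m) u) • (A ^ j) w) d
    rw [htop, Function.iterate_zero_apply, minpoly.aeval] at htel
    simp only [map_one, Module.End.one_apply, LinearMap.zero_apply, map_zero, zero_smul,
      sub_zero, sum_sub_distrib] at htel
    rw [Module.End.mul_apply, Module.End.mul_apply, hC, hC, map_sum]
    simp only [hstep, map_sub, map_smul, sub_smul, sum_sub_distrib, smul_eq_mul,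
      ← Module.End.mul_apply, ← pow_succ']
    have hlast : ∑ j ∈ range d, (m.coeff j * f u) • (A ^ j) w = - (f u • (A ^ d) w) := by
      rw [← smul_neg, ← eq_neg_of_add_eq_zero_left hzero, smul_sum]
      exact sum_congr rfl fun j _ => by rw [smul_smul, mul_comm]
    rw [hlast, ← htel]
    abel
  · rw [hC, sum_eq_single 0]
    · rw [hf, coeff_iterate_divX, show d - 1 + (0 + 1) = d by omega, hmonic.coeff_natDegree]
      · simp
      · exact degree_divX_lt hmonic.ne_zero
    · intro j _ hj
      rw [hf, coeff_iterate_divX, coeff_eq_zero_of_natDegree_lt (by omega), zero_smul]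
      rw [← hm, degree_eq_natDegree hmonic.ne_zero, degree_lt_iff_coeff_zero]
      intro n hn
      rw [coeff_iterate_divX]
      exact coeff_eq_zero_of_natDegree_lt (by omega)
    · intro h
      exact absurd (mem_range.mpr hdpos) h
  · refine ⟨∑ j ∈ range d, monomial j (f (aeval A (divX^[j + 1] m) u)), ?_⟩
    simp [hC, aeval_monomial, LinearMap.sum_apply]

/-- The double commutant theorem for a single endomorphism of a finite-dimensional space. -/
theorem exists_eq_aeval_of_forall_commute {A B : Module.End K V}
    (h : ∀ C : Module.End K V, Commute A C → Commute B C) : ∃ p : K[X], B = aeval A p := by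
  obtain ⟨v, hv⟩ := exists_maximal_vector A
  have key : ∀ C : Module.End K V, Commute A C → ∀ u, B (C u) = C (B u) :=
    fun C hC u => LinearMap.congr_fun (h C hC).eq u
  obtain ⟨C, hC, hCv, hCr⟩ := exists_commute_apply_eq hv v
  obtain ⟨p, hp⟩ := hCr (B v)
  refine ⟨p, LinearMap.ext fun w => ?_⟩
  obtain ⟨D, hD, hDv, -⟩ := exists_commute_apply_eq hv w
  have hBv : B v = aeval A p v := by rw [← hp, ← key C hC, hCv]
  have hcomm : Commute D (aeval A p) :=
    Algebra.commute_of_mem_adjoin_of_forall_mem_commute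
      (aeval_mem_adjoin_singleton K A) (by simpa using hD.symm)
  rw [← hDv, key D hD, hBv]
  exact LinearMap.congr_fun hcomm.eq v

theorem eq_zero_of_forall_trace_mul_eq_zero {D : Module.End K V}
    (h : ∀ Z : Module.End K V, LinearMap.trace K V (Z * D) = 0) : D = 0 := by
  ext x
  refine (Module.forall_dual_apply_eq_zero_iff K (D x)).mp fun φ => ?_
  have h1 : (φ.smulRight x : Module.End K V) * D = (φ ∘ₗ D).smulRight x := rfl
  have h2 := h (φ.smulRight x)
  rwa [h1, LinearMap.trace_smulRight] at h2

/-- If the image of `ad B` is contained in that of `ad A`, then `B` is a polynomial in `A`. -/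
theorem exists_eq_aeval_of_forall_exists_commutator_eq {A B : Module.End K V}
    (h : ∀ Z : Module.End K V, ∃ W : Module.End K V, W * A - A * W = Z * B - B * Z) :
    ∃ p : K[X], B = aeval A p := by
  refine exists_eq_aeval_of_forall_commute fun C hC => ?_
  refine sub_eq_zero.mp (eq_zero_of_forall_trace_mul_eq_zero fun Z => ?_)
  obtain ⟨W, hW⟩ := h Z
  have h1 : LinearMap.trace K V (Z * (B * C - C * B)) =
      LinearMap.trace K V ((Z * B - B * Z) * C) := by
    simp only [mul_sub, sub_mul, map_sub, ← mul_assoc]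
    rw [LinearMap.trace_mul_cycle K B Z C, LinearMap.trace_mul_cycle K Z C B,
      LinearMap.trace_mul_cycle K B Z C]
  rw [h1, ← hW, sub_mul, map_sub, mul_assoc W A C, hC.eq, ← mul_assoc,
    LinearMap.trace_mul_cycle K W C A, sub_self]

end Module.End

section SkewHerm

variable {V : Type*} [AddCommGroup V] [Module ℝ V] {g : V →ₗ[ℝ] V →ₗ[ℝ] ℝ}

theorem exists_adjoint [FiniteDimensional ℝ V]
    (hgnd : ∀ x : V, (∀ y : V, g x y = 0) → x = 0) (Z : Module.End ℝ V) :
    ∃ Z' : Module.End ℝ V, ∀ x y, g (Z' x) y = g x (Z y) := by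
  have hinj : Function.Injective g :=
    (injective_iff_map_eq_zero g).mpr fun x hx => hgnd x fun y => by rw [hx]; rfl
  let e : V ≃ₗ[ℝ] Module.Dual ℝ V :=
    LinearEquiv.ofInjectiveOfFinrankEq g hinj Subspace.dual_finrank_eq.symm
  refine ⟨e.symm.toLinearMap ∘ₗ LinearMap.lcomp ℝ ℝ Z ∘ₗ g, fun x y => ?_⟩
  exact LinearMap.congr_fun (e.apply_symm_apply (LinearMap.lcomp ℝ ℝ Z (g x))) y

theorem apply_complex_structure_left {J : Module.End ℝ V} (hJ2 : J * J = -1)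
    (hJg : ∀ x y : V, g (J x) (J y) = g x y) (x y : V) : g (J x) y = - g x (J y) := by
  have h : J (J y) = - y := LinearMap.congr_fun hJ2 y
  rw [← hJg x (J y), h, map_neg, neg_neg]

/-- The `J`-linear endomorphisms are the complexification of `u(g,J)`. -/
theorem SkewHerm.exists_eq_add_mul [FiniteDimensional ℝ V] {J : Module.End ℝ V}
    (hgsymm : ∀ x y : V, g x y = g y x) (hgnd : ∀ x : V, (∀ y : V, g x y = 0) → x = 0)
    (hJ2 : J * J = -1) (hJg : ∀ x y : V, g (J x) (J y) = g x y)
    {Z : Module.End ℝ V} (hZ : Z * J = J * Z) :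
    ∃ X Y : Module.End ℝ V, SkewHerm g J X ∧ SkewHerm g J Y ∧ Z = X + J * Y := by
  obtain ⟨Z', hZ'⟩ := exists_adjoint hgnd Z
  have hJs := apply_complex_structure_left hJ2 hJg
  have hZx : ∀ x, Z (J x) = J (Z x) := fun x => LinearMap.congr_fun hZ x
  have hJJ : ∀ x, J (J x) = - x := fun x => LinearMap.congr_fun hJ2 x
  have hZ'' : ∀ x y, g (Z x) y = g x (Z' y) := fun x y => by
    rw [hgsymm, ← hZ', hgsymm]
  have hZ'x : ∀ x, Z' (J x) = J (Z' x) := by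
    intro x
    refine sub_eq_zero.mp (hgnd _ fun y => ?_)
    rw [map_sub, LinearMap.sub_apply, hZ', hJs, hJs, hZ', hZx, sub_self]
  refine ⟨(1 / 2 : ℝ) • (Z - Z'), (-1 / 2 : ℝ) • (J * (Z + Z')), ⟨fun x y => ?_, ?_⟩,
    ⟨fun x y => ?_, ?_⟩, ?_⟩
  · simp only [LinearMap.smul_apply, LinearMap.sub_apply, map_smul, map_sub, hZ', hZ'', smul_eq_mul]
    ring
  · ext x
    simp [hZx, hZ'x]
  · simp only [LinearMap.smul_apply, LinearMap.add_apply, Module.End.mul_apply, map_smul, map_add,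
      hZ', hZ'', hJs, smul_eq_mul, hZx, hZ'x]
    ring
  · ext x
    simp [hZx, hZ'x]
  · ext x
    simp only [LinearMap.smul_apply, LinearMap.add_apply, LinearMap.sub_apply,
      Module.End.mul_apply, map_smul, map_add, hJJ]
    module

theorem apply_aeval_left {A : Module.End ℝ V} (hA : ∀ x y : V, g (A x) y = g x (A y))
    (p : ℝ[X]) (x y : V) : g (aeval A p x) y = g x (aeval A p y) := by
  have hpow : ∀ (n : ℕ) (x y : V), g ((A ^ n) x) y = g x ((A ^ n) y) := by
    intro n
    induction n with
    | zero => exact fun _ _ => rfl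
    | succ n ih =>
      intro x y
      rw [pow_succ', Module.End.mul_apply, hA, ih, ← Module.End.mul_apply, ← pow_succ, pow_succ']
  simp [aeval_eq_sum_range, LinearMap.sum_apply, hpow]

end SkewHerm

theorem exists_real_aeval_add_I_smul {V : Type*} [AddCommGroup V] [Module ℝ V] [Module ℂ V]
    [IsScalarTower ℝ ℂ V] (A : Module.End ℂ V) (p : ℂ[X]) :
    ∃ a b : ℝ[X], ∀ x, aeval A p x =
      aeval (A.restrictScalars ℝ) a x + Complex.I • aeval (A.restrictScalars ℝ) b x := by
  have hpow : ∀ (n : ℕ) (x : V), ((A.restrictScalars ℝ) ^ n) x = (A ^ n) x := by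
    intro n
    induction n with
    | zero => exact fun _ => rfl
    | succ n ih => intro x; rw [pow_succ, pow_succ, Module.End.mul_apply, ih]; rfl
  have hcoe : ∀ (r : ℝ) (y : V), (r : ℂ) • y = r • y := fun r y => by
    rw [← smul_one_smul ℂ r y, Complex.real_smul, mul_one]
  induction p using Polynomial.induction_on' with
  | add p q hp hq =>
    obtain ⟨a, b, h⟩ := hp
    obtain ⟨a', b', h'⟩ := hq
    refine ⟨a + a', b + b', fun x => ?_⟩
    simp only [map_add, LinearMap.add_apply, h, h']
    module
  | monomial n c =>
    refine ⟨monomial n c.re, monomial n c.im, fun x => ?_⟩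
    simp only [aeval_monomial, Module.End.mul_apply, Module.algebraMap_end_apply, hpow]
    conv_lhs => rw [← Complex.re_add_im c]
    rw [add_smul, mul_comm, mul_smul, hcoe, hcoe]

/-- If a map `𝖱 : u(g,J) → u(g,J)` satisfies `[𝖱(X), A] = [X, B]` for all `X ∈ u(g,J)`,
then `B` is a real polynomial in `A`. -/
theorem stmt3
    (V : Type*) [AddCommGroup V] [Module ℝ V] [FiniteDimensional ℝ V]
    (g : V →ₗ[ℝ] V →ₗ[ℝ] ℝ)
    (hgsymm : ∀ x y : V, g x y = g y x)
    (hgnd : ∀ x : V, (∀ y : V, g x y = 0) → x = 0)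
    (J : Module.End ℝ V)
    (hJ2 : J * J = -1)
    (hJg : ∀ x y : V, g (J x) (J y) = g x y)
    (A : Module.End ℝ V)
    (hAg : ∀ x y : V, g (A x) y = g x (A y))
    (hAJ : A * J = J * A)
    (B : Module.End ℝ V)
    (hBg : ∀ x y : V, g (B x) y = g x (B y))
    (hBJ : B * J = J * B)
    (R : Module.End ℝ V → Module.End ℝ V)
    (hmem : ∀ X : Module.End ℝ V, SkewHerm g J X → SkewHerm g J (R X))
    (hcomm : ∀ X : Module.End ℝ V, SkewHerm g J X →
      R X * A - A * R X = X * B - B * X) :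
    ∃ q : Polynomial ℝ, B = Polynomial.aeval A q := by
  have hJs := apply_complex_structure_left hJ2 hJg
  let _ : Module ℂ V := Module.compHom V (Complex.liftAux J hJ2).toRingHom
  have hsmul : ∀ (z : ℂ) (x : V), z • x = z.re • x + z.im • J x := fun _ _ => rfl
  have hI : ∀ x : V, Complex.I • x = J x := fun x => by simp [hsmul]
  have : IsScalarTower ℝ ℂ V := ⟨fun r z x => by
    simp only [hsmul, Complex.smul_re, Complex.smul_im, smul_eq_mul]; module⟩
  have : FiniteDimensional ℂ V := Module.Finite.of_restrictScalars_finite ℝ ℂ V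
  have hlift : ∀ T : Module.End ℝ V, T * J = J * T →
      ∃ T' : Module.End ℂ V, ∀ x, T' x = T x := fun T hT =>
    ⟨{ toFun := T
       map_add' := map_add T
       map_smul' := fun z x => by
        have h : T (J x) = J (T x) := LinearMap.congr_fun hT x
        simp [hsmul, h] }, fun _ => rfl⟩
  obtain ⟨A', hA'⟩ := hlift A hAJ
  obtain ⟨B', hB'⟩ := hlift B hBJ
  have himage : ∀ Z : Module.End ℂ V, ∃ W : Module.End ℂ V,
      W * A' - A' * W = Z * B' - B' * Z := by
    intro Z
    obtain ⟨X, Y, hX, hY, hXY⟩ := SkewHerm.exists_eq_add_mul hgsymm hgnd hJ2 hJg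
      (Z := Z.restrictScalars ℝ) (by ext x; simp [← hI])
    obtain ⟨W, hW⟩ := hlift (R X + J * R Y) (by
      rw [add_mul, mul_add, (hmem X hX).2, mul_assoc, (hmem Y hY).2])
    refine ⟨W, LinearMap.ext fun x => ?_⟩
    have hZ : ∀ x, Z x = X x + J (Y x) := fun x => LinearMap.congr_fun hXY x
    have hx := LinearMap.congr_fun (hcomm X hX) x
    have hy := congrArg J (LinearMap.congr_fun (hcomm Y hY) x)
    have hAx : ∀ x, A (J x) = J (A x) := fun x => LinearMap.congr_fun hAJ x
    have hBx : ∀ x, B (J x) = J (B x) := fun x => LinearMap.congr_fun hBJ x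
    simp only [LinearMap.sub_apply, LinearMap.add_apply, Module.End.mul_apply, map_sub, map_add,
      hA', hB', hW, hZ, hAx, hBx] at hx hy ⊢
    rw [add_sub_add_comm, hx, hy, add_sub_add_comm]
  obtain ⟨p, hp⟩ := Module.End.exists_eq_aeval_of_forall_exists_commutator_eq himage
  obtain ⟨a, b, hab⟩ := exists_real_aeval_add_I_smul A' p
  have hAA : A'.restrictScalars ℝ = A := LinearMap.ext hA'
  have hBab : ∀ x, B x = aeval A a x + J (aeval A b x) := fun x => by
    rw [← hB', hp, hab, hI, hAA]
  have hcb : Commute J (aeval A b) :=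
    Algebra.commute_of_mem_adjoin_of_forall_mem_commute
      (aeval_mem_adjoin_singleton ℝ A) (by simpa using show Commute J A from hAJ.symm)
  have hbJ : ∀ x, aeval A b (J x) = J (aeval A b x) :=
    fun x => (LinearMap.congr_fun hcb.eq x).symm
  refine ⟨a, LinearMap.ext fun x => ?_⟩
  have hzero : J (aeval A b x) = 0 := by
    refine hgnd _ fun y => ?_
    have h := hBg x y
    rw [hBab, hBab, map_add, map_add, LinearMap.add_apply, apply_aeval_left hAg a,
      add_right_inj, ← hbJ y, ← apply_aeval_left hAg b] at h
    have h' := hJs (aeval A b x) y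
    linarith
  rw [hBab, hzero, add_zero]
end
end

section
/- Let (V,g,J) be a pseudo-hermitian vector space, A a hermitian endomorphism of V, and k ≥ 1 an integer. For the monomial q(t) = t^k, the Ricci tensor of the Kähler curvature tensor R_{q,A} = −(1/8) Σ_{r+s=k−1} R_{A^r,A^s} is given by Ric(R_{q,A})(x,y) = g(x, C y) for all x,y ∈ V, where C is the endomorphism C = −(1/4)·Σ_{r=0}^{k−1} tr(A^{k−1−r})·A^r − (k/2)·A^{k−1}. -/
open Finset Polynomial

noncomputable section

/-- Kulkarni–Nomizu product of two bilinear forms (as 4-tensor):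
`(P⊘Q)(x,y,u,v) = P(x,u)Q(y,v) − P(x,v)Q(y,u) + Q(x,u)P(y,v) − Q(x,v)P(y,u)`. -/
def KN4 {V : Type*} [AddCommGroup V] [Module ℝ V] (P Q : V → V → ℝ) (x y u v : V) : ℝ :=
  P x u * Q y v - P x v * Q y u + Q x u * P y v - Q x v * P y u

/-- Symmetric product `(P⊙Q)(x,y,u,v) = P(x,y)Q(u,v) + Q(x,y)P(u,v)`. -/
def SP4 {V : Type*} [AddCommGroup V] [Module ℝ V] (P Q : V → V → ℝ) (x y u v : V) : ℝ :=
  P x y * Q u v + Q x y * P u v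

/-- `R_{A,B} = gA⊘gB + ωA⊘ωB + 2·ωA⊙ωB`, where `gA = g(A·,·)` and `ωA = ω(A·,·)`
with `ω(x,y) = g(Jx,y)`. -/
def RAB {V : Type*} [AddCommGroup V] [Module ℝ V]
    (g : V →ₗ[ℝ] V →ₗ[ℝ] ℝ) (J A B : Module.End ℝ V) (x y u v : V) : ℝ :=
  KN4 (fun a b => g (A a) b) (fun a b => g (B a) b) x y u v
    + KN4 (fun a b => g (J (A a)) b) (fun a b => g (J (B a)) b) x y u v
    + 2 * SP4 (fun a b => g (J (A a)) b) (fun a b => g (J (B a)) b) x y u v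

/-- A linear endomorphism which is skew-adjoint for a nondegenerate bilinear form has trace zero. -/
theorem trace_eq_zero_of_skew {V : Type*} [AddCommGroup V] [Module ℝ V] [FiniteDimensional ℝ V]
    (g : V →ₗ[ℝ] V →ₗ[ℝ] ℝ) (hgnd : ∀ x : V, (∀ y : V, g x y = 0) → x = 0)
    (S : Module.End ℝ V) (hS : ∀ x y, g (S x) y = -g x (S y)) :
    LinearMap.trace ℝ V S = 0 := by
  have hinj : Function.Injective g := by
    refine (injective_iff_map_eq_zero g).2 fun x hx => hgnd x fun y => ?_
    simp [hx]
  let e : V ≃ₗ[ℝ] Module.Dual ℝ V :=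
    LinearMap.linearEquivOfInjective g hinj Subspace.dual_finrank_eq.symm
  have hconj : e.conj S = (-1 : ℝ) • Module.Dual.transpose (R := ℝ) S := by
    ext f x
    obtain ⟨v, rfl⟩ := e.surjective f
    have he : ∀ a b, e a b = g a b := fun a b => rfl
    simp [LinearEquiv.conj_apply, he, hS, Module.Dual.transpose_apply]
  have h := LinearMap.trace_conj' S e
  rw [hconj, map_smul, LinearMap.trace_transpose', neg_one_smul] at h
  linarith

/-- The trace of `z ↦ R(z,x)y` for the tensor `R = R_{P,Q}` of commuting hermitian `P` and `Q`. -/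
theorem trace_of_RAB {V : Type*} [AddCommGroup V] [Module ℝ V] [FiniteDimensional ℝ V]
    (g : V →ₗ[ℝ] V →ₗ[ℝ] ℝ)
    (hgsymm : ∀ x y : V, g x y = g y x)
    (hgnd : ∀ x : V, (∀ y : V, g x y = 0) → x = 0)
    (J P Q : Module.End ℝ V)
    (hJJ : ∀ x, J (J x) = -x)
    (hJg : ∀ x y : V, g (J x) y = -g x (J y))
    (hP : ∀ x y : V, g (P x) y = g x (P y))
    (hQ : ∀ x y : V, g (Q x) y = g x (Q y))
    (hPJ : ∀ x, P (J x) = J (P x)) (hQJ : ∀ x, Q (J x) = J (Q x))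
    (hPQ : ∀ x, Q (P x) = P (Q x)) (x y : V) :
    ∃ M : Module.End ℝ V, (∀ w z, g w (M z) = RAB g J P Q w y z x) ∧
      LinearMap.trace ℝ V M = LinearMap.trace ℝ V P * g x (Q y)
        + LinearMap.trace ℝ V Q * g x (P y) + 4 * g x (P (Q y)) := by
  have hsP : LinearMap.trace ℝ V (J * P) = 0 :=
    trace_eq_zero_of_skew g hgnd _ fun a b => by simp [hJg, hP, hPJ]
  have hsQ : LinearMap.trace ℝ V (J * Q) = 0 :=
    trace_eq_zero_of_skew g hgnd _ fun a b => by simp [hJg, hQ, hQJ]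
  have hsymm : g y (P (Q x)) = g x (P (Q y)) := by rw [hgsymm, hP, hQ, hPQ]
  refine ⟨g x (Q y) • P - (g (Q y)).smulRight (P x) + g x (P y) • Q - (g (P y)).smulRight (Q x)
    - g x (J (Q y)) • (J * P) + (g (J (Q y))).smulRight (J (P x))
    - g x (J (P y)) • (J * Q) + (g (J (P y))).smulRight (J (Q x))
    + (2 : ℝ) • (g (Q (J x))).smulRight (J (P y))
    + (2 : ℝ) • (g (P (J x))).smulRight (J (Q y)), fun w z => ?_, ?_⟩
  · have hPx : ∀ v, g v (P x) = g x (P v) := fun v => by rw [hgsymm, hP]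
    have hQx : ∀ v, g v (Q x) = g x (Q v) := fun v => by rw [hgsymm, hQ]
    have hJPx : ∀ v, g v (J (P x)) = -g x (J (P v)) := fun v => by
      rw [hgsymm, hJg, hP, hPJ]
    have hJQx : ∀ v, g v (J (Q x)) = -g x (J (Q v)) := fun v => by
      rw [hgsymm, hJg, hQ, hQJ]
    simp only [RAB, KN4, SP4, LinearMap.add_apply, LinearMap.sub_apply, LinearMap.smul_apply,
      LinearMap.smulRight_apply, Module.End.mul_apply, map_add, map_sub, map_smul, smul_eq_mul,
      hJg, hP, hQ, hPJ, hQJ]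
    rw [hPx y, hQx y, hJPx y, hJQx y, hJPx z, hJQx z]
    ring
  · simp only [map_add, map_sub, map_smul, smul_eq_mul, LinearMap.trace_smulRight, hsP, hsQ,
      hJg, hP, hQ, hPJ, hQJ, hJJ, hPQ, hsymm, map_neg]
    ring

/-- Ricci tensor of `R_{t^k,A} = −(1/8)Σ_{r+s=k−1} R_{A^r,A^s}`:
`Ric(x,y) = g(x, C y)` with `C = −(1/4)Σ_{r=0}^{k−1} tr(A^{k−1−r})·A^r − (k/2)·A^{k−1}`. -/
theorem stmt5
    (V : Type*) [AddCommGroup V] [Module ℝ V] [FiniteDimensional ℝ V]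
    (g : V →ₗ[ℝ] V →ₗ[ℝ] ℝ)
    (hgsymm : ∀ x y : V, g x y = g y x)
    (hgnd : ∀ x : V, (∀ y : V, g x y = 0) → x = 0)
    (J : Module.End ℝ V)
    (hJ2 : J * J = -1)
    (hJg : ∀ x y : V, g (J x) (J y) = g x y)
    (A : Module.End ℝ V)
    (hAg : ∀ x y : V, g (A x) y = g x (A y))
    (hAJ : A * J = J * A)
    (k : ℕ) (hk : 1 ≤ k)
    (Rend : V → V → V → V)
    (hRend : ∀ x y u v : V, g x (Rend u v y) =
      -(1 / 8 : ℝ) * ∑ r ∈ Finset.range k, RAB g J (A ^ r) (A ^ (k - 1 - r)) x y u v) :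
    ∀ (x y : V) (L : V →ₗ[ℝ] V), (∀ z : V, L z = Rend z x y) →
      LinearMap.trace ℝ V L =
        g x (((-(1 / 4 : ℝ)) • (∑ r ∈ Finset.range k, LinearMap.trace ℝ V (A ^ (k - 1 - r)) • A ^ r)
          - ((k : ℝ) / 2) • A ^ (k - 1)) y) := by
  intro x y L hL
  have hJJ : ∀ v, J (J v) = -v := fun v => by
    simpa using LinearMap.congr_fun hJ2 v
  have hJs : ∀ v w, g (J v) w = -g v (J w) := fun v w => by
    rw [← hJg v (J w), hJJ, map_neg, neg_neg]
  have hpow : ∀ n : ℕ, ∀ v w, g ((A ^ n) v) w = g v ((A ^ n) w) := by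
    intro n
    induction n with
    | zero => simp
    | succ n ih =>
      intro v w
      rw [pow_succ, Module.End.mul_apply, ih, hAg, ← Module.End.mul_apply, ← pow_succ', pow_succ]
  have hpowJ : ∀ n : ℕ, ∀ v, (A ^ n) (J v) = J ((A ^ n) v) := fun n v =>
    LinearMap.congr_fun ((show Commute A J from hAJ).pow_left n).eq v
  have hpp : ∀ m n : ℕ, ∀ v, (A ^ n) ((A ^ m) v) = (A ^ m) ((A ^ n) v) := fun m n v =>
    LinearMap.congr_fun (Commute.pow_pow_self A n m).eq v
  choose M hM hMtr using fun r : ℕ =>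
    trace_of_RAB g hgsymm hgnd J (A ^ r) (A ^ (k - 1 - r)) hJJ hJs (hpow r) (hpow _) (hpowJ r)
      (hpowJ _) (hpp _ _) x y
  have hLM : L = (-(1 / 8 : ℝ)) • ∑ r ∈ Finset.range k, M r := by
    ext z
    rw [← sub_eq_zero]
    refine hgnd _ fun w => ?_
    rw [hgsymm, map_sub, hL, hRend]
    simp [LinearMap.sum_apply, hM]
  have hrefl : ∑ r ∈ Finset.range k, LinearMap.trace ℝ V (A ^ r) * g x ((A ^ (k - 1 - r)) y)
      = ∑ r ∈ Finset.range k, LinearMap.trace ℝ V (A ^ (k - 1 - r)) * g x ((A ^ r) y) := by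
    rw [← Finset.sum_range_reflect]
    refine Finset.sum_congr rfl fun r hr => ?_
    rw [Nat.sub_sub_self (by have := Finset.mem_range.1 hr; omega)]
  have hprod : ∑ r ∈ Finset.range k, 4 * g x ((A ^ r) ((A ^ (k - 1 - r)) y))
      = k * (4 * g x ((A ^ (k - 1)) y)) := by
    rw [Finset.sum_congr rfl (g := fun _ => 4 * g x ((A ^ (k - 1)) y)), Finset.sum_const,
      Finset.card_range, nsmul_eq_mul]
    intro r hr
    rw [← Module.End.mul_apply, ← pow_add,
      Nat.add_sub_of_le (by have := Finset.mem_range.1 hr; omega)]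
  rw [hLM, map_smul, map_sum, Finset.sum_congr rfl fun r _ => hMtr r, Finset.sum_add_distrib,
    Finset.sum_add_distrib, hrefl, hprod]
  simp only [LinearMap.sub_apply, LinearMap.smul_apply, LinearMap.sum_apply, map_sub, map_smul,
    map_sum, smul_eq_mul]
  ring
end
end

section
/- Let (V,g,J) be a pseudo-hermitian vector space. Define the linear map pr on multilinear maps R : V⁴ → ℝ by pr(R)(x,y,u,v) = (1/16)·[3R(x,y,u,v) + 3R(Jx,Jy,u,v) + 3R(x,y,Ju,Jv) + 3R(Jx,Jy,Ju,Jv) + R(x,Ju,v,Jy) − R(x,v,Jy,Ju) + R(x,Jv,Jy,u) − R(x,u,Jv,Jy) + R(Jx,u,Jv,y) − R(Jx,Jv,y,u) + R(Jx,v,y,Ju) − R(Jx,Ju,v,y)]. Then: (i) for every R ∈ R(V), pr(R) ∈ K(V); (ii) pr(R) = R for every R ∈ K(V). Consequently pr∘pr = pr on R(V) and the image of R(V) under pr is exactly K(V). -/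
noncomputable section

/-- Multilinearity of a 4-tensor `V⁴ → ℝ`. -/
def IsMulti4 {V : Type*} [AddCommGroup V] [Module ℝ V] (R : V → V → V → V → ℝ) : Prop :=
  (∀ (a : ℝ) (x x' y u v : V),
    R (x + x') y u v = R x y u v + R x' y u v ∧ R (a • x) y u v = a * R x y u v) ∧
  (∀ (a : ℝ) (x y y' u v : V),
    R x (y + y') u v = R x y u v + R x y' u v ∧ R x (a • y) u v = a * R x y u v) ∧
  (∀ (a : ℝ) (x y u u' v : V),
    R x y (u + u') v = R x y u v + R x y u' v ∧ R x y (a • u) v = a * R x y u v) ∧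
  (∀ (a : ℝ) (x y u v v' : V),
    R x y u (v + v') = R x y u v + R x y u v' ∧ R x y u (a • v) = a * R x y u v)

/-- Algebraic curvature tensors: multilinear maps `V⁴ → ℝ` satisfying (K1)–(K3). -/
def IsACT {V : Type*} [AddCommGroup V] [Module ℝ V] (R : V → V → V → V → ℝ) : Prop :=
  IsMulti4 R ∧
  (∀ x y u v : V, R x y u v = -R y x u v) ∧
  (∀ x y u v : V, R x y u v = -R x y v u) ∧
  (∀ x y u v : V, R x y u v = R u v x y) ∧
  (∀ x y u v : V, R x y u v + R x v y u + R x u v y = 0)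

/-- Kähler algebraic curvature tensors: algebraic curvature tensors which also
satisfy (K4). -/
def IsKACT {V : Type*} [AddCommGroup V] [Module ℝ V]
    (J : Module.End ℝ V) (R : V → V → V → V → ℝ) : Prop :=
  IsACT R ∧
  (∀ x y u v : V, R x y u v = R (J x) (J y) u v) ∧
  (∀ x y u v : V, R x y u v = R x y (J u) (J v))

/-- The projection operator `pr` from Lemma 2.4. -/
def pr {V : Type*} [AddCommGroup V] [Module ℝ V]
    (J : Module.End ℝ V) (R : V → V → V → V → ℝ) (x y u v : V) : ℝ :=
  (1 / 16 : ℝ) *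
    (3 * R x y u v + 3 * R (J x) (J y) u v + 3 * R x y (J u) (J v)
      + 3 * R (J x) (J y) (J u) (J v)
      + R x (J u) v (J y) - R x v (J y) (J u) + R x (J v) (J y) u - R x u (J v) (J y)
      + R (J x) u (J v) y - R (J x) (J v) y u + R (J x) v y (J u) - R (J x) (J u) v y)

/-- For an algebraic curvature tensor, the first argument can be exchanged with any other one
while exchanging the remaining two. -/
theorem IsACT.klein {V : Type*} [AddCommGroup V] [Module ℝ V]
    {R : V → V → V → V → ℝ} (hR : IsACT R) (x y u v : V) :
    R y x v u = R x y u v ∧ R u v x y = R x y u v ∧ R v u y x = R x y u v := by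
  obtain ⟨-, h1, h2, h3, -⟩ := hR
  refine ⟨?_, ?_, ?_⟩ <;>
    linarith [h1 x y u v, h2 y x u v, h3 x y u v, h1 u v x y, h2 v u x y]

theorem IsMulti4.pr {V : Type*} [AddCommGroup V] [Module ℝ V] (J : Module.End ℝ V)
    {R : V → V → V → V → ℝ} (hR : IsMulti4 R) : IsMulti4 (pr J R) := by
  obtain ⟨h1, h2, h3, h4⟩ := hR
  have a1 := fun x x' y u v => (h1 0 x x' y u v).1
  have a2 := fun x y y' u v => (h2 0 x y y' u v).1
  have a3 := fun x y u u' v => (h3 0 x y u u' v).1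
  have a4 := fun x y u v v' => (h4 0 x y u v v').1
  have s1 := fun a x y u v => (h1 a x x y u v).2
  have s2 := fun a x y u v => (h2 a x y y u v).2
  have s3 := fun a x y u v => (h3 a x y u u v).2
  have s4 := fun a x y u v => (h4 a x y u v v).2
  refine ⟨?_, ?_, ?_, ?_⟩ <;> intros <;> constructor <;>
    simp only [_root_.pr, map_add, map_smul, a1, a2, a3, a4, s1, s2, s3, s4] <;> ring

theorem IsMulti4.neg {V : Type*} [AddCommGroup V] [Module ℝ V]
    {R : V → V → V → V → ℝ} (hR : IsMulti4 R) (x y u v : V) :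
    R (-x) y u v = -R x y u v ∧ R x (-y) u v = -R x y u v ∧
    R x y (-u) v = -R x y u v ∧ R x y u (-v) = -R x y u v := by
  obtain ⟨h1, h2, h3, h4⟩ := hR
  have := (h1 (-1) x x y u v).2
  have := (h2 (-1) x y y u v).2
  have := (h3 (-1) x y u u v).2
  have := (h4 (-1) x y u v v).2
  simp_all

theorem IsACT.isKACT_pr {V : Type*} [AddCommGroup V] [Module ℝ V] {J : Module.End ℝ V}
    (hJ : ∀ x, J (J x) = -x) {R : V → V → V → V → ℝ} (hR : IsACT R) : IsKACT J (pr J R) := by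
  have n1 := fun x y u v => (hR.1.neg x y u v).1
  have n2 := fun x y u v => (hR.1.neg x y u v).2.1
  have n3 := fun x y u v => (hR.1.neg x y u v).2.2.1
  have n4 := fun x y u v => (hR.1.neg x y u v).2.2.2
  have h := hR
  obtain ⟨-, h1, h2, h3, h4⟩ := h
  refine ⟨⟨hR.1.pr J, ?_, ?_, ?_, ?_⟩, ?_, ?_⟩ <;> intro x y u v <;>
    simp only [pr, hJ, n1, n2, n3, n4]
  · grind
  · grind
  · have k1 := fun x y u v => (hR.klein x y u v).1
    have k3 := fun x y u v => (hR.klein x y u v).2.2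
    rw [h3 u v x y, h3 (J u) (J v) x y, h3 u v (J x) (J y), h3 (J u) (J v) (J x) (J y),
      k1 (J x) u (J v) y, k3 (J x) (J v) y u, k3 x (J v) (J y) u, k1 x u (J v) (J y),
      k1 x (J u) v (J y), k3 x v (J y) (J u), k3 (J x) v y (J u), k1 (J x) (J u) v y]
    ring
  · grind
  · grind
  · grind

theorem IsKACT.pr_eq_self {V : Type*} [AddCommGroup V] [Module ℝ V] {J : Module.End ℝ V}
    (hJ : ∀ x, J (J x) = -x) {R : V → V → V → V → ℝ} (hR : IsKACT J R) : pr J R = R := by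
  have n1 := fun x y u v => (hR.1.1.neg x y u v).1
  have n2 := fun x y u v => (hR.1.1.neg x y u v).2.1
  have n3 := fun x y u v => (hR.1.1.neg x y u v).2.2.1
  have n4 := fun x y u v => (hR.1.1.neg x y u v).2.2.2
  obtain ⟨⟨-, h1, h2, h3, h4⟩, k1, k2⟩ := hR
  funext x y u v
  simp only [pr]
  grind

/-- `pr` maps `R(V)` onto `K(V)`, restricts to the identity on `K(V)`, and is
idempotent on `R(V)`. -/
theorem stmt11
    (V : Type*) [AddCommGroup V] [Module ℝ V] [FiniteDimensional ℝ V]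
    (g : V →ₗ[ℝ] V →ₗ[ℝ] ℝ)
    (hgsymm : ∀ x y : V, g x y = g y x)
    (hgnd : ∀ x : V, (∀ y : V, g x y = 0) → x = 0)
    (J : Module.End ℝ V)
    (hJ2 : J * J = -1)
    (hJg : ∀ x y : V, g (J x) (J y) = g x y) :
    (∀ R : V → V → V → V → ℝ, IsACT R → IsKACT J (pr J R)) ∧
    (∀ R : V → V → V → V → ℝ, IsKACT J R → pr J R = R) ∧
    (∀ R : V → V → V → V → ℝ, IsACT R → pr J (pr J R) = pr J R) ∧
    (∀ S : V → V → V → V → ℝ, IsKACT J S ↔ ∃ R : V → V → V → V → ℝ, IsACT R ∧ pr J R = S) := by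
  have hJ : ∀ x, J (J x) = -x := fun x => by
    simpa using congrArg (fun f : Module.End ℝ V => f x) hJ2
  refine ⟨fun R hR => hR.isKACT_pr hJ, fun R hR => hR.pr_eq_self hJ,
    fun R hR => (hR.isKACT_pr hJ).pr_eq_self hJ, fun S => ⟨fun hS => ⟨S, hS.1, hS.pr_eq_self hJ⟩, ?_⟩⟩
  rintro ⟨R, hR, rfl⟩
  exact hR.isKACT_pr hJ
end
end

section
/- Let (V,g,J) be a pseudo-hermitian vector space, A a hermitian endomorphism of V, and φ ∈ K(V) a Kähler algebraic curvature tensor such that the associated endomorphisms commute with A: [φ(u,v), A] = 0 for all u,v ∈ V (where φ(u,v) is the unique endomorphism with g(x, φ(u,v)y) = φ(x,y,u,v)). Let V_ℂ := ℂ ⊗_ℝ V be the complexification, A_ℂ the ℂ-linear extension of A, g_ℂ the ℂ-bilinear extension of g, and φ_ℂ : V_ℂ × V_ℂ → End_ℂ(V_ℂ) the ℂ-bilinear extension of (u,v) ↦ φ(u,v); set φ_ℂ(x,y,u,v) := g_ℂ(x, φ_ℂ(u,v)y). For λ ∈ ℂ let V_λ denote the generalized eigenspace ∪_m ker((A_ℂ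 − λ·id)^m). Then φ_ℂ(x₁,x₂,x₃,x₄) = 0 whenever there are indices i ≠ j and distinct λ, μ ∈ ℂ with x_i ∈ V_λ and x_j ∈ V_μ. -/
open scoped TensorProduct

noncomputable section

/-- Generalized eigenspaces for distinct eigenvalues of an operator `f` are orthogonal with
respect to every bilinear form for which `f` is self-adjoint. -/
theorem LinearMap.apply_eq_zero_of_pow_sub_smul_one {K W : Type*} [Field K] [AddCommGroup W]
    [Module K W] (B : W →ₗ[K] W →ₗ[K] K) (f : Module.End K W)
    (hB : ∀ x y, B (f x) y = B x (f y)) {lam mu : K} (hne : lam ≠ mu) {x y : W} {M N : ℕ}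
    (hx : ((f - lam • (1 : Module.End K W)) ^ M) x = 0)
    (hy : ((f - mu • (1 : Module.End K W)) ^ N) y = 0) : B x y = 0 := by
  have hpow : ∀ (n : ℕ) (a b : W), B (((f - mu • (1 : Module.End K W)) ^ n) a) b
      = B a (((f - mu • (1 : Module.End K W)) ^ n) b) := by
    intro n
    induction n with
    | zero => intro a b; simp
    | succ n ih =>
      intro a b
      rw [pow_succ, Module.End.mul_apply, ih, ← pow_succ, pow_succ', Module.End.mul_apply]
      simp [hB]
  obtain ⟨p, q, hpq⟩ := (Polynomial.isCoprime_X_sub_C_of_isUnit_sub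
    (sub_ne_zero.mpr hne).isUnit).pow (m := M) (n := N)
  have hsplit := congrArg (fun r ↦ Polynomial.aeval f r x) hpq
  have hq : (f - mu • (1 : Module.End K W)) ^ N =
      Polynomial.aeval f ((Polynomial.X - Polynomial.C mu) ^ N) := by
    simp [Algebra.algebraMap_eq_smul_one]
  simp only [map_add, map_mul, map_pow, map_sub, Polynomial.aeval_X, Polynomial.aeval_C, map_one,
    Algebra.algebraMap_eq_smul_one, LinearMap.add_apply, Module.End.mul_apply, hx, map_zero,
    zero_add, Module.End.one_apply] at hsplit
  have hcomm : Polynomial.aeval f q (((f - mu • (1 : Module.End K W)) ^ N) x) =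
      ((f - mu • (1 : Module.End K W)) ^ N) (Polynomial.aeval f q x) := by
    rw [hq, ← Module.End.mul_apply, ← Module.End.mul_apply, ← map_mul, ← map_mul, mul_comm]
  rw [← hsplit, hcomm, hpow, hy, map_zero]

/-- A linear function on a base change vanishes if it vanishes on the vectors `1 ⊗ₜ v`. -/
theorem IsLinearMap.eq_zero_of_one_tmul {R S V M : Type*} [CommSemiring R] [Semiring S]
    [Algebra R S] [AddCommMonoid V] [Module R V] [AddCommMonoid M] [Module S M]
    {T : S ⊗[R] V → M} (hT : IsLinearMap S T) (h : ∀ v : V, T (1 ⊗ₜ[R] v) = 0)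
    (x : S ⊗[R] V) : T x = 0 := by
  induction x with
  | zero => exact hT.map_zero
  | tmul c v =>
    rw [← mul_one c, ← smul_eq_mul, ← TensorProduct.smul_tmul', hT.map_smul, h, smul_zero]
  | add x y hx hy => rw [hT.map_add, hx, hy, add_zero]

/-- A function of four vectors of a base change that is linear in each of them vanishes if it
vanishes on the vectors `1 ⊗ₜ v`. -/
theorem eq_zero_of_isLinearMap_of_one_tmul {R S V M : Type*} [CommSemiring R] [Semiring S]
    [Algebra R S] [AddCommMonoid V] [Module R V] [AddCommMonoid M] [Module S M]
    (T : S ⊗[R] V → S ⊗[R] V → S ⊗[R] V → S ⊗[R] V → M)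
    (h₁ : ∀ y u v, IsLinearMap S fun x ↦ T x y u v)
    (h₂ : ∀ x u v, IsLinearMap S fun y ↦ T x y u v)
    (h₃ : ∀ x y v, IsLinearMap S fun u ↦ T x y u v)
    (h₄ : ∀ x y u, IsLinearMap S fun v ↦ T x y u v)
    (h : ∀ x y u v : V, T (1 ⊗ₜ[R] x) (1 ⊗ₜ[R] y) (1 ⊗ₜ[R] u) (1 ⊗ₜ[R] v) = 0)
    (x y u v : S ⊗[R] V) : T x y u v = 0 :=
  (h₁ y u v).eq_zero_of_one_tmul (fun x ↦
    (h₂ _ u v).eq_zero_of_one_tmul (fun y ↦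
      (h₃ _ _ v).eq_zero_of_one_tmul (fun u ↦
        (h₄ _ _ _).eq_zero_of_one_tmul (h x y u) v) u) y) x

/-- An algebraic curvature tensor for which `f` is self-adjoint in the first pair of arguments
vanishes as soon as two arguments lie in generalized eigenspaces of `f` for distinct
eigenvalues. -/
theorem curvature_eq_zero_of_mem_maxGenEigenspace {K W : Type*} [Field K] [IsAlgClosed K]
    [AddCommGroup W] [Module K W] [FiniteDimensional K W]
    (F : W →ₗ[K] W →ₗ[K] W →ₗ[K] W →ₗ[K] K) (f : Module.End K W)
    (hf : ∀ x y u v, F (f x) y u v = F x (f y) u v)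
    (anti : ∀ x y u v, F x y u v = -F y x u v)
    (pair : ∀ x y u v, F x y u v = F u v x y)
    (bianchi : ∀ x y u v, F x y u v + F x v y u + F x u v y = 0)
    (m : Fin 4 → W) {i j : Fin 4} {lam mu : K} (hij : i ≠ j) (hne : lam ≠ mu)
    (hi : m i ∈ f.maxGenEigenspace lam) (hj : m j ∈ f.maxGenEigenspace mu) :
    F (m 0) (m 1) (m 2) (m 3) = 0 := by
  have anti' : ∀ x y u v, F x y u v = -F x y v u := fun x y u v ↦ by
    rw [pair, anti, pair]
  have first {a b : K} (hab : a ≠ b) {x y : W} (hx : x ∈ f.maxGenEigenspace a)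
      (hy : y ∈ f.maxGenEigenspace b) (u v : W) : F x y u v = 0 := by
    obtain ⟨M, hM⟩ := (f.mem_maxGenEigenspace a x).1 hx
    obtain ⟨N, hN⟩ := (f.mem_maxGenEigenspace b y).1 hy
    have h (x y : W) : F x y u v = ((F.flip.flip.compr₂ (LinearMap.applyₗ u)).compr₂
      (LinearMap.applyₗ v)) x y := by simp
    rw [h]
    exact LinearMap.apply_eq_zero_of_pow_sub_smul_one _ f
      (fun x y ↦ by rw [← h, ← h, hf]) hab hM hN
  have second {a b : K} (hab : a ≠ b) {u v : W} (hu : u ∈ f.maxGenEigenspace a)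
      (hv : v ∈ f.maxGenEigenspace b) (x y : W) : F x y u v = 0 := by
    rw [pair, first hab hu hv]
  have top (x : W) : x ∈ ⨆ a, f.maxGenEigenspace a := by
    simp [Module.End.iSup_maxGenEigenspace_eq_top]
  have mixed {a b : K} (hab : a ≠ b) {x u : W} (hx : x ∈ f.maxGenEigenspace a)
      (hu : u ∈ f.maxGenEigenspace b) (y v : W) : F x y u v = 0 := by
    induction top y using Submodule.iSup_induction' with
    | zero => simp
    | add y z _ _ hy hz => simp [hy, hz]
    | mem c y hy =>
      rcases eq_or_ne a c with rfl | hac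
      · induction top v using Submodule.iSup_induction' with
        | zero => simp
        | add v w _ _ hv hw => simp [hv, hw]
        | mem d v hv =>
          rcases eq_or_ne b d with rfl | hbd
          · simpa [first hab hx hv, first hab hx hu] using bianchi x y u v
          · exact second hbd hu hv x y
      · exact first hac hx hy u v
  have mixed' {a b : K} (hab : a ≠ b) {x v : W} (hx : x ∈ f.maxGenEigenspace a)
      (hv : v ∈ f.maxGenEigenspace b) (y u : W) : F x y u v = 0 := by
    rw [anti', mixed hab hx hv, neg_zero]
  have key {i j : Fin 4} {a b : K} (hij : i < j) (hab : a ≠ b)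
      (hi : m i ∈ f.maxGenEigenspace a) (hj : m j ∈ f.maxGenEigenspace b) :
      F (m 0) (m 1) (m 2) (m 3) = 0 := by
    fin_cases i <;> fin_cases j <;> (first | exact absurd hij (by decide) | skip) <;>
      dsimp at hi hj
    · exact first hab hi hj _ _
    · exact mixed hab hi hj _ _
    · exact mixed' hab hi hj _ _
    · rw [anti, mixed hab hi hj, neg_zero]
    · rw [anti, mixed' hab hi hj, neg_zero]
    · exact second hab hi hj _ _
  rcases lt_or_gt_of_ne hij with h | h
  · exact key h hne hi hj
  · exact key h hne.symm hj hi

/-- A Kähler algebraic curvature tensor whose curvature endomorphisms commute with a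
hermitian endomorphism `A` vanishes (after complexification) whenever two of its
arguments lie in generalized eigenspaces of `A_ℂ` for distinct eigenvalues. -/
theorem stmt12
    (V : Type*) [AddCommGroup V] [Module ℝ V] [FiniteDimensional ℝ V]
    (g : V →ₗ[ℝ] V →ₗ[ℝ] ℝ)
    (hgsymm : ∀ x y : V, g x y = g y x)
    (hgnd : ∀ x : V, (∀ y : V, g x y = 0) → x = 0)
    (J : Module.End ℝ V)
    (hJ2 : J * J = -1)
    (hJg : ∀ x y : V, g (J x) (J y) = g x y)
    (A : Module.End ℝ V)
    (hAg : ∀ x y : V, g (A x) y = g x (A y))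
    (hAJ : A * J = J * A)
    (φ : V → V → V → V → ℝ)
    (φend : V → V → Module.End ℝ V)
    (hφ : ∀ x y u v : V, g x (φend u v y) = φ x y u v)
    (hK1 : ∀ x y u v : V, φ x y u v = -φ y x u v)
    (hK1' : ∀ x y u v : V, φ x y u v = -φ x y v u)
    (hK2 : ∀ x y u v : V, φ x y u v = φ u v x y)
    (hK3 : ∀ x y u v : V, φ x y u v + φ x v y u + φ x u v y = 0)
    (hK4a : ∀ x y u v : V, φ x y u v = φ (J x) (J y) u v)
    (hK4b : ∀ x y u v : V, φ x y u v = φ x y (J u) (J v))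
    (hcomm : ∀ u v : V, φend u v * A = A * φend u v)
    (gC : (ℂ ⊗[ℝ] V) →ₗ[ℂ] (ℂ ⊗[ℝ] V) →ₗ[ℂ] ℂ)
    (hgC : ∀ x y : V, gC ((1 : ℂ) ⊗ₜ[ℝ] x) ((1 : ℂ) ⊗ₜ[ℝ] y) = (g x y : ℂ))
    (φC : (ℂ ⊗[ℝ] V) →ₗ[ℂ] (ℂ ⊗[ℝ] V) →ₗ[ℂ] ((ℂ ⊗[ℝ] V) →ₗ[ℂ] (ℂ ⊗[ℝ] V)))
    (hφC : ∀ u v y : V, φC ((1 : ℂ) ⊗ₜ[ℝ] u) ((1 : ℂ) ⊗ₜ[ℝ] v) ((1 : ℂ) ⊗ₜ[ℝ] y)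
      = (1 : ℂ) ⊗ₜ[ℝ] (φend u v y)) :
    ∀ (m : Fin 4 → ℂ ⊗[ℝ] V) (i j : Fin 4) (lam mu : ℂ),
      i ≠ j → lam ≠ mu →
      (∃ N : ℕ, ((LinearMap.baseChange ℂ (A : V →ₗ[ℝ] V)
        - lam • (1 : Module.End ℂ (ℂ ⊗[ℝ] V))) ^ N) (m i) = 0) →
      (∃ N : ℕ, ((LinearMap.baseChange ℂ (A : V →ₗ[ℝ] V)
        - mu • (1 : Module.End ℂ (ℂ ⊗[ℝ] V))) ^ N) (m j) = 0) →
      gC (m 0) (φC (m 2) (m 3) (m 1)) = 0 := by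
  intro m i j lam mu hij hne hi hj
  set AC : Module.End ℂ (ℂ ⊗[ℝ] V) := LinearMap.baseChange ℂ A
  have hA1 (x : V) : AC (1 ⊗ₜ[ℝ] x) = 1 ⊗ₜ[ℝ] A x := LinearMap.baseChange_tmul ..
  let L : Module.End ℂ (ℂ ⊗[ℝ] V) →ₗ[ℂ] (ℂ ⊗[ℝ] V) →ₗ[ℂ] (ℂ ⊗[ℝ] V) →ₗ[ℂ] ℂ :=
    { toFun := fun f ↦ gC.compl₂ f
      map_add' := fun f h ↦ by ext; simp
      map_smul' := fun c f ↦ by ext; simp }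
  let F := φC.compr₂ L
  have hF (x y u v : ℂ ⊗[ℝ] V) : F x y u v = gC u (φC x y v) := rfl
  have hF1 (x y u v : V) :
      F (1 ⊗ₜ[ℝ] x) (1 ⊗ₜ[ℝ] y) (1 ⊗ₜ[ℝ] u) (1 ⊗ₜ[ℝ] v) = (φ x y u v : ℂ) := by
    rw [hF, hφC, hgC, hφ, hK2]
  have hAφ (x y u v : V) : φ (A x) y u v = φ x (A y) u v := by
    rw [← hφ, ← hφ, hAg, ← Module.End.mul_apply, ← hcomm, Module.End.mul_apply]
  have hf (x y u v : ℂ ⊗[ℝ] V) : F (AC x) y u v = F x (AC y) u v := by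
    refine sub_eq_zero.1 (eq_zero_of_isLinearMap_of_one_tmul
      (fun x y u v ↦ F (AC x) y u v - F x (AC y) u v) ?_ ?_ ?_ ?_ ?_ x y u v)
    on_goal 5 => intro x y u v; simp only [hA1, hF1, hAφ, sub_self]
    all_goals intros; constructor <;> intros <;> simp <;> ring
  have anti (x y u v : ℂ ⊗[ℝ] V) : F x y u v = -F y x u v := by
    refine eq_neg_of_add_eq_zero_left (eq_zero_of_isLinearMap_of_one_tmul
      (fun x y u v ↦ F x y u v + F y x u v) ?_ ?_ ?_ ?_ ?_ x y u v)
    on_goal 5 => intro x y u v; rw [hF1, hF1, hK1]; simp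
    all_goals intros; constructor <;> intros <;> simp <;> ring
  have pair (x y u v : ℂ ⊗[ℝ] V) : F x y u v = F u v x y := by
    refine sub_eq_zero.1 (eq_zero_of_isLinearMap_of_one_tmul
      (fun x y u v ↦ F x y u v - F u v x y) ?_ ?_ ?_ ?_ ?_ x y u v)
    on_goal 5 => intro x y u v; rw [hF1, hF1, hK2, sub_self]
    all_goals intros; constructor <;> intros <;> simp <;> ring
  have bianchi (x y u v : ℂ ⊗[ℝ] V) : F x y u v + F x v y u + F x u v y = 0 := by
    refine eq_zero_of_isLinearMap_of_one_tmul
      (fun x y u v ↦ F x y u v + F x v y u + F x u v y) ?_ ?_ ?_ ?_ ?_ x y u v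
    on_goal 5 => intro x y u v; simp only [hF1]; exact_mod_cast hK3 x y u v
    all_goals intros; constructor <;> intros <;> simp <;> ring
  rw [← hF, pair]
  exact curvature_eq_zero_of_mem_maxGenEigenspace F AC hf anti pair bianchi m hij hne
    ((AC.mem_maxGenEigenspace lam _).2 hi) ((AC.mem_maxGenEigenspace mu _).2 hj)
end
end

section
/- Let (V,g,J) be a pseudo-hermitian vector space, A a hermitian endomorphism of V, and q a real polynomial. Then: (i) for every λ ∈ ℝ, R_{q,A} = R_{q̃, A−λ·id}, where q̃(t) := q(t+λ); (ii) the zero-order term of q does not contribute: for every constant c ∈ ℝ, R_{q+c, A} = R_{q,A}. -/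
open Finset Polynomial

noncomputable section

/-- `R_{q,A} = −(1/8)·Σ_{k} a_k Σ_{r+s=k−1} R_{A^r,A^s}` for a real polynomial
`q(t) = Σ_k a_k t^k`. -/
def RqA {V : Type*} [AddCommGroup V] [Module ℝ V]
    (g : V →ₗ[ℝ] V →ₗ[ℝ] ℝ) (J : Module.End ℝ V) (q : Polynomial ℝ)
    (A : Module.End ℝ V) (x y u v : V) : ℝ :=
  -(1 / 8 : ℝ) * ∑ k ∈ Finset.range (q.natDegree + 1), q.coeff k *
    ∑ r ∈ Finset.range k, RAB g J (A ^ r) (A ^ (k - 1 - r)) x y u v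

/-- The noncommutative divided difference `∑ aₖ tᵏ ↦ ∑ aₖ ∑_{r+s=k-1} aʳ bˢ`,
as a linear map on polynomials. -/
def dividedDiff {K S : Type*} [CommRing K] [Ring S] [Algebra K S] (a b : S) : K[X] →ₗ[K] S :=
  Polynomial.lsum fun k =>
    LinearMap.toSpanSingleton K S (∑ r ∈ Finset.range k, a ^ r * b ^ (k - 1 - r))

section DividedDiff

variable {K S : Type*} [CommRing K] [Ring S] [Algebra K S]

theorem dividedDiff_monomial (a b : S) (n : ℕ) (c : K) :
    dividedDiff a b (monomial n c) = c • ∑ r ∈ Finset.range n, a ^ r * b ^ (n - 1 - r) := by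
  simp [dividedDiff, Polynomial.lsum_apply, Polynomial.sum_monomial_index]

@[simp]
theorem dividedDiff_C (a b : S) (c : K) : dividedDiff a b (C c) = 0 := by
  simp [← monomial_zero_left, dividedDiff_monomial]

theorem dividedDiff_X_mul (a b : S) (p : K[X]) :
    dividedDiff a b (X * p) = a * dividedDiff a b p + aeval b p := by
  induction p using Polynomial.induction_on' with
  | add p q hp hq => rw [mul_add, map_add, hp, hq, map_add, map_add, mul_add]; abel
  | monomial n c =>
    rw [X_mul_monomial, dividedDiff_monomial, dividedDiff_monomial, Finset.sum_range_succ',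
      aeval_monomial, mul_smul_comm, smul_add, Finset.mul_sum, ← Algebra.smul_def]
    congr 2
    · refine Finset.sum_congr rfl fun r _ => ?_
      rw [pow_succ', mul_assoc]
      congr 3
      omega
    · simp

theorem dividedDiff_comp_X_add_C (a b : S) (c : K) (q : K[X]) :
    dividedDiff (a - c • (1 : S)) (b - c • (1 : S)) (q.comp (X + C c))
      = dividedDiff a b q := by
  rw [← Algebra.algebraMap_eq_smul_one]
  induction q using Polynomial.induction_on with
  | C d => simp
  | add p q hp hq => rw [add_comp, map_add, map_add, hp, hq]
  | monomial n d ih =>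
    have hX : (C d * X ^ (n + 1) : K[X]) = X * (C d * X ^ n) := by ring
    rw [hX]
    generalize (C d * X ^ n : K[X]) = p at ih ⊢
    rw [mul_comp, X_comp, add_mul, map_add, dividedDiff_X_mul, dividedDiff_X_mul, ← smul_eq_C_mul,
      map_smul, ih, aeval_comp, sub_mul, Algebra.smul_def]
    simp only [map_add, aeval_X, aeval_C, sub_add_cancel]
    abel

end DividedDiff

open scoped TensorProduct

section CurvatureTensor

variable {V : Type*} [AddCommGroup V] [Module ℝ V]
  (g : V →ₗ[ℝ] V →ₗ[ℝ] ℝ) (J : Module.End ℝ V)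

/-- For fixed arguments, `R_{A,B}` as a linear functional of `A ⊗ B`. -/
def tensorRAB (x y u v : V) : Module.End ℝ V ⊗[ℝ] Module.End ℝ V →ₗ[ℝ] ℝ :=
  TensorProduct.lift <| LinearMap.mk₂ ℝ (fun A B => RAB g J A B x y u v)
    (fun _ _ _ => by simp only [RAB, KN4, SP4, LinearMap.add_apply, map_add]; ring)
    (fun _ _ _ => by
      simp only [RAB, KN4, SP4, LinearMap.smul_apply, map_smul, smul_eq_mul]; ring)
    (fun _ _ _ => by simp only [RAB, KN4, SP4, LinearMap.add_apply, map_add]; ring)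
    (fun _ _ _ => by
      simp only [RAB, KN4, SP4, LinearMap.smul_apply, map_smul, smul_eq_mul]; ring)

theorem RqA_eq_tensorRAB_dividedDiff (q : ℝ[X]) (A : Module.End ℝ V) (x y u v : V) :
    RqA g J q A x y u v = -(1 / 8 : ℝ) * tensorRAB g J x y u v
      (dividedDiff (A ⊗ₜ[ℝ] (1 : Module.End ℝ V)) ((1 : Module.End ℝ V) ⊗ₜ[ℝ] A) q) := by
  rw [RqA, dividedDiff, Polynomial.lsum_apply, Polynomial.sum_over_range _ (by simp)]
  simp [tensorRAB]

end CurvatureTensor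

/-- (i) `R_{q,A} = R_{q̃, A−λ·id}` with `q̃(t) = q(t+λ)`;
(ii) the zero-order term of `q` does not contribute: `R_{q + c, A} = R_{q,A}`. -/
theorem stmt14
    (V : Type*) [AddCommGroup V] [Module ℝ V] [FiniteDimensional ℝ V]
    (g : V →ₗ[ℝ] V →ₗ[ℝ] ℝ)
    (hgsymm : ∀ x y : V, g x y = g y x)
    (hgnd : ∀ x : V, (∀ y : V, g x y = 0) → x = 0)
    (J : Module.End ℝ V)
    (hJ2 : J * J = -1)
    (hJg : ∀ x y : V, g (J x) (J y) = g x y)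
    (A : Module.End ℝ V)
    (hAg : ∀ x y : V, g (A x) y = g x (A y))
    (hAJ : A * J = J * A)
    (q : Polynomial ℝ) :
    (∀ lam : ℝ, ∀ x y u v : V,
      RqA g J q A x y u v
        = RqA g J (q.comp (Polynomial.X + Polynomial.C lam))
            (A - lam • (1 : Module.End ℝ V)) x y u v) ∧
    (∀ c : ℝ, ∀ x y u v : V,
      RqA g J (q + Polynomial.C c) A x y u v = RqA g J q A x y u v) := by
  refine ⟨fun lam x y u v => ?_, fun c x y u v => ?_⟩
  · rw [RqA_eq_tensorRAB_dividedDiff, RqA_eq_tensorRAB_dividedDiff, TensorProduct.sub_tmul,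
      TensorProduct.tmul_sub, ← TensorProduct.smul_tmul', TensorProduct.tmul_smul,
      ← Algebra.TensorProduct.one_def]
    congr 2
    exact (dividedDiff_comp_X_add_C _ _ lam q).symm
  · rw [RqA_eq_tensorRAB_dividedDiff, RqA_eq_tensorRAB_dividedDiff, map_add, dividedDiff_C,
      add_zero]
end
end

section
/- Let ℓ ≥ 1 and k ≥ 0 be integers, let f₁,…,f_ℓ : ℝ → ℝ be smooth functions, and let h : ℝ^ℓ → ℝ be a polynomial function of total degree ≤ k. Suppose that for every (ρ₁,…,ρ_ℓ) ∈ ℝ^ℓ with pairwise distinct coordinates one has Σ_{i=1}^ℓ f_i(ρ_i)/Δ_i = h(ρ₁,…,ρ_ℓ), where Δ_i := ∏_{j≠i}(ρ_i − ρ_j). Then there exists a single real polynomial f of degree ≤ ℓ + k − 1 such that f_i(t) = f(t) for every i = 1,…,ℓ and every t ∈ ℝ. -/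
open Finset

noncomputable section

open Polynomial in
/-- Freeze all coordinates but the `i`-th at the nodes `a` and clear denominators in
`Σ_j c_j/Δ_j = P`: the `i`-th numerator is the value of this polynomial. -/
def numeratorPoly {ι : Type*} [Fintype ι] [DecidableEq ι] (P : MvPolynomial ι ℝ)
    (i : ι) (a c : ι → ℝ) : ℝ[X] :=
  MvPolynomial.aeval (Function.update (fun m => C (a m)) i X) P *
      ∏ j ∈ univ.erase i, (X - C (a j)) +
    ∑ j ∈ univ.erase i, C (c j / ∏ m ∈ (univ.erase i).erase j, (a j - a m)) *
      ∏ m ∈ (univ.erase i).erase j, (X - C (a m))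

section

variable {ι : Type*} [Fintype ι] [DecidableEq ι] (P : MvPolynomial ι ℝ) (i : ι) (a c : ι → ℝ)

open Polynomial in
theorem natDegree_numeratorPoly_le :
    (numeratorPoly P i a c).natDegree ≤ P.totalDegree + (Fintype.card ι - 1) := by
  have hprod (s : Finset ι) : (∏ m ∈ s, (X - C (a m))).natDegree ≤ #s := by simp
  have hcard : #(univ.erase i) = Fintype.card ι - 1 := by
    rw [card_erase_of_mem (mem_univ i), card_univ]
  refine natDegree_add_le_of_degree_le ?_ (natDegree_sum_le_of_forall_le _ _ fun j _ => ?_)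
  · refine natDegree_mul_le_of_le ?_ (hcard ▸ hprod _)
    refine (MvPolynomial.aeval_natDegree_le P le_rfl _ (n := 1) fun m => ?_).trans_eq (mul_one _)
    by_cases h : m = i
    · subst h; simp
    · simp [h]
  · refine (natDegree_C_mul_le _ _).trans ((hprod _).trans ?_)
    exact (card_le_card (erase_subset _ _)).trans (hcard.trans_le (Nat.le_add_left _ _))

theorem eval_numeratorPoly (t : ℝ) :
    (numeratorPoly P i a c).eval t =
      MvPolynomial.eval (Function.update a i t) P * ∏ j ∈ univ.erase i, (t - a j) +
        ∑ j ∈ univ.erase i, c j / (∏ m ∈ (univ.erase i).erase j, (a j - a m)) *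
          ∏ m ∈ (univ.erase i).erase j, (t - a m) := by
  have hP : (MvPolynomial.aeval (Function.update (fun m => Polynomial.C (a m)) i Polynomial.X)
      P).eval t = MvPolynomial.eval (Function.update a i t) P := by
    rw [← Polynomial.coe_evalRingHom, MvPolynomial.map_aeval, MvPolynomial.eval,
      MvPolynomial.coe_eval₂Hom, MvPolynomial.coe_eval₂Hom]
    refine congrArg₂ (fun φ g => MvPolynomial.eval₂ φ g P) (by ext; simp) (funext fun m => ?_)
    by_cases h : m = i
    · subst h; simp
    · simp [h]
  simp [numeratorPoly, hP, Polynomial.eval_finsetSum, Polynomial.eval_prod]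

variable {a} in
theorem eval_numeratorPoly_node (ha : Function.Injective a) {j : ι} (hj : j ≠ i) :
    (numeratorPoly P i a c).eval (a j) = c j := by
  have hmem : j ∈ univ.erase i := by simp [hj]
  rw [eval_numeratorPoly, prod_eq_zero hmem (sub_self _), mul_zero, zero_add,
    sum_eq_single_of_mem j hmem]
  · refine div_mul_cancel₀ _ (prod_ne_zero_iff.2 fun m hm => sub_ne_zero.2 fun h => ?_)
    exact ne_of_mem_erase hm (ha h).symm
  · intro b _ hb
    exact mul_eq_zero_of_right _ (prod_eq_zero (mem_erase.2 ⟨hb.symm, hmem⟩) (sub_self _))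

variable {P a} in
theorem eq_eval_numeratorPoly_of_sum_div {t : ℝ} (hta : ∀ j ≠ i, t ≠ a j) {y : ℝ}
    (h : ∑ j, Function.update c i y j /
        ∏ m ∈ univ.erase j, (Function.update a i t j - Function.update a i t m) =
      MvPolynomial.eval (Function.update a i t) P) :
    y = (numeratorPoly P i a c).eval t := by
  have hD : ∏ j ∈ univ.erase i, (t - a j) ≠ 0 :=
    prod_ne_zero_iff.2 fun j hj => sub_ne_zero.2 (hta j (ne_of_mem_erase hj))
  have hi : ∏ m ∈ univ.erase i, (Function.update a i t i - Function.update a i t m) =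
      ∏ j ∈ univ.erase i, (t - a j) :=
    prod_congr rfl fun m hm => by simp [ne_of_mem_erase hm]
  rw [eval_numeratorPoly, ← h, ← add_sum_erase _ _ (mem_univ i), hi, Function.update_self,
    add_mul, div_mul_cancel₀ _ hD, add_assoc, left_eq_add, sum_mul, ← sum_add_distrib]
  refine sum_eq_zero fun j hj => ?_
  have hji := ne_of_mem_erase hj
  have hj' : ∏ m ∈ univ.erase j, (Function.update a i t j - Function.update a i t m) =
      (a j - t) * ∏ m ∈ (univ.erase i).erase j, (a j - a m) := by
    rw [← mul_prod_erase _ _ (mem_erase.2 ⟨hji.symm, mem_univ i⟩), erase_right_comm]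
    congr 1
    · simp [hji]
    · exact prod_congr rfl fun m hm => by
        simp [hji, ne_of_mem_erase (mem_of_mem_erase hm)]
  have hne : t - a j ≠ 0 := sub_ne_zero.2 (hta j hji)
  rw [hj', ← mul_prod_erase _ _ hj, Function.update_of_ne hji, ← neg_sub t (a j), neg_mul,
    div_neg, mul_comm (t - a j), ← div_div, neg_mul, ← mul_assoc,
    div_mul_cancel₀ _ hne]
  exact neg_add_cancel _

end

/-- If smooth functions `f₁,…,f_ℓ` satisfy `Σ_i f_i(ρ_i)/Δ_i = h(ρ)` for all pairwise
distinct `ρ₁,…,ρ_ℓ`, where `h` is a polynomial of total degree `≤ k`, then all `f_i`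
coincide with a single polynomial of degree `≤ ℓ+k−1`. -/
theorem stmt16
    (ℓ k : ℕ) (hl : 1 ≤ ℓ)
    (f : Fin ℓ → ℝ → ℝ) (hf : ∀ i, ContDiff ℝ (⊤ : ℕ∞) (f i))
    (P : MvPolynomial (Fin ℓ) ℝ) (hP : P.totalDegree ≤ k)
    (hmain : ∀ ρ : Fin ℓ → ℝ, Function.Injective ρ →
      ∑ i, f i (ρ i) / ∏ j ∈ Finset.univ.erase i, (ρ i - ρ j) = MvPolynomial.eval ρ P) :
    ∃ F : Polynomial ℝ, F.natDegree ≤ ℓ + k - 1 ∧ ∀ (i : Fin ℓ) (t : ℝ), f i t = F.eval t := by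
  have key (i : Fin ℓ) (a : Fin ℓ → ℝ) (ha : Function.Injective a) (t : ℝ) :
      f i t = (numeratorPoly P i a fun j => f j (a j)).eval t := by
    have hdense : Dense (Set.range a)ᶜ := (Set.finite_range a).countable.dense_compl ℝ
    refine congrFun (Continuous.ext_on hdense (hf i).continuous
      (Polynomial.continuous _) fun s hs => ?_) t
    have hsa (j : Fin ℓ) : s ≠ a j := fun h => hs ⟨j, h.symm⟩
    refine eq_eval_numeratorPoly_of_sum_div i _ (fun j _ => hsa j) ?_
    rw [← hmain]
    · refine sum_congr rfl fun j _ => ?_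
      congr 1
      by_cases h : j = i
      · subst h; simp
      · simp [h]
    · intro x y hxy
      by_cases hx : x = i <;> by_cases hy : y = i <;>
        simp_all [ha.eq_iff, (hsa _).symm]
  have heq (i j : Fin ℓ) (t : ℝ) : f i t = f j t := by
    obtain rfl | hij := eq_or_ne j i
    · rfl
    let a : Fin ℓ → ℝ := fun m => t + ((m : ℕ) - (j : ℕ) : ℝ)
    have ha : Function.Injective a := fun x y hxy => by simpa [a, Fin.ext_iff] using hxy
    have haj : a j = t := by simp [a]
    have h := key i a ha (a j)
    rwa [eval_numeratorPoly_node P i _ ha hij, haj] at h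
  let a : Fin ℓ → ℝ := fun m => (m : ℕ)
  have ha : Function.Injective a := fun x y hxy => by simpa [a, Fin.ext_iff] using hxy
  refine ⟨numeratorPoly P ⟨0, hl⟩ a fun j => f j (a j), ?_, fun i t => ?_⟩
  · refine (natDegree_numeratorPoly_le _ _ _ _).trans ?_
    rw [Fintype.card_fin]
    omega
  · rw [heq i ⟨0, hl⟩ t, key ⟨0, hl⟩ a ha t]
end
end

section
/- Let F be a field, ℓ ≥ 1, let ρ₁,…,ρ_ℓ ∈ F be pairwise distinct, set Δ_i := ∏_{j≠i}(ρ_i − ρ_j) and p(t) := ∏_{i=1}^ℓ (t − ρ_i), and let μ₁, μ₂ be the first and second elementary symmetric polynomials in ρ₁,…,ρ_ℓ. Let Θ ∈ F[t] be a polynomial of degree ≤ ℓ+2 and write C₂, C₁, C₀ for its coefficients of t^{ℓ+2}, t^{ℓ+1}, t^{ℓ} respectively. Then for every t ∈ F with t ≠ ρ_i for all i, Σ_{i=1}^ℓ Θ(ρ_i)/(Δ_i·(ρ_i − t)) = −Θ(t)/p(t) + C₂t² + (C₂μ₁ + C₁)t + C₂(μ₁² − μ₂) + C₁μ₁ + C₀.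 -/
open Finset

noncomputable section

open Polynomial in
theorem coeff_nodal_eq_sum_powersetCard {R ι : Type*} [CommRing R] (s : Finset ι) (v : ι → R)
    {k m : ℕ} (h : m + k = #s) :
    (Lagrange.nodal s v).coeff m = (-1) ^ k * ∑ S ∈ s.powersetCard k, ∏ i ∈ S, v i := by
  have hm : m ≤ Multiset.card (s.val.map v) := by simp; omega
  have hk : Multiset.card (s.val.map v) - m = k := by simp; omega
  have hp := Multiset.prod_X_sub_C_coeff (s.val.map v) hm
  rw [hk, Finset.esymm_map_val, Multiset.map_map] at hp
  exact hp

open Polynomial in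
/-- The part of degree at least `#s` is removed from `f` by subtracting from it the multiple of the
nodal polynomial by the polynomial part of `f / nodal s v`. -/
theorem degree_sub_nodal_mul_lt {R ι : Type*} [CommRing R] [Nontrivial R]
    (s : Finset ι) (hs : s.Nonempty) (v : ι → R) (f : R[X]) (hf : f.natDegree ≤ #s + 2) :
    (f - Lagrange.nodal s v *
      (C (f.coeff (#s + 2)) * X ^ 2
        + C (f.coeff (#s + 2) * ∑ i ∈ s, v i + f.coeff (#s + 1)) * X
        + C (f.coeff (#s + 2) *
              ((∑ i ∈ s, v i) ^ 2 - ∑ S ∈ s.powersetCard 2, ∏ i ∈ S, v i)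
            + f.coeff (#s + 1) * ∑ i ∈ s, v i + f.coeff #s))).degree < (#s : WithBot ℕ) := by
  have hpos := hs.card_pos
  set p := Lagrange.nodal s v with hp
  have hdeg : p.natDegree = #s := Lagrange.natDegree_nodal
  have h_zero (n : ℕ) (hn : #s < n) : p.coeff n = 0 :=
    coeff_eq_zero_of_natDegree_lt (hdeg ▸ hn)
  have h_top : p.coeff #s = 1 := by
    simpa using coeff_nodal_eq_sum_powersetCard s v (k := 0) (m := #s) (by simp)
  have h_one : (p * X).coeff #s = -∑ i ∈ s, v i := by
    obtain ⟨m, hm⟩ := Nat.exists_eq_add_of_lt hpos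
    rw [zero_add] at hm
    rw [hm, coeff_mul_X, hp, coeff_nodal_eq_sum_powersetCard s v (k := 1) hm.symm]
    simp [Finset.powersetCard_one]
  have h_two : (p * X ^ 2).coeff #s = ∑ S ∈ s.powersetCard 2, ∏ i ∈ S, v i := by
    rw [coeff_mul_X_pow']
    split_ifs with h
    · rw [hp, coeff_nodal_eq_sum_powersetCard s v (k := 2) (Nat.sub_add_cancel h)]
      simp
    · rw [Finset.powersetCard_eq_empty.2 (not_le.1 h), Finset.sum_empty]
  have h_two_succ : (p * X ^ 2).coeff (#s + 1) = -∑ i ∈ s, v i := by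
    rw [pow_two, ← mul_assoc, coeff_mul_X, h_one]
  rw [degree_lt_iff_coeff_zero]
  intro n hn
  have expand (a b c : R) : p * (C a * X ^ 2 + C b * X + C c)
      = C a * (p * X ^ 2) + C b * (p * X) + C c * p := by ring
  rw [expand]
  simp only [coeff_sub, coeff_add, coeff_C_mul]
  obtain rfl | rfl | hn2 : n = #s ∨ n = #s + 1 ∨ #s + 2 ≤ n := by omega
  · rw [h_two, h_one, h_top]
    ring
  · rw [h_two_succ, coeff_mul_X, h_top, h_zero _ (by omega)]
    ring
  · obtain ⟨m, rfl⟩ := Nat.exists_eq_add_of_le' hn2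
    rw [← add_assoc, coeff_mul_X_pow, coeff_mul_X, h_zero (m + #s + 1) (by omega),
      h_zero (m + #s + 2) (by omega)]
    obtain rfl | hm := Nat.eq_zero_or_pos m
    · simp [h_top]
    · rw [h_zero _ (by omega), coeff_eq_zero_of_natDegree_lt (n := m + #s + 2) (by omega)]
      ring

open Polynomial in
theorem eval_div_eval_nodal {F ι : Type*} [Field F] [DecidableEq ι] (s : Finset ι) (v : ι → F)
    (hv : Set.InjOn v s) (f : F[X]) (hf : f.degree < (#s : WithBot ℕ)) (t : F) (ht : ∀ i ∈ s, t ≠ v i) :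
    f.eval t / ∏ i ∈ s, (t - v i)
      = ∑ i ∈ s, f.eval (v i) / ((∏ j ∈ s.erase i, (v i - v j)) * (t - v i)) := by
  have h := Lagrange.eval_interpolate_not_at_node (fun i => f.eval (v i)) ht
  rw [← Lagrange.eq_interpolate hv hf, Lagrange.eval_nodal] at h
  rw [h, mul_div_cancel_left₀ _ (Finset.prod_ne_zero_iff.2 fun i hi => sub_ne_zero.2 (ht i hi))]
  refine Finset.sum_congr rfl fun i _ => ?_
  rw [Lagrange.nodalWeight, Finset.prod_inv_distrib, div_eq_mul_inv, mul_inv]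
  ring

/-- Lemma 3.1(c): for `Θ` a polynomial of degree `≤ ℓ+2` with leading coefficients
`C₂, C₁, C₀` (of `t^{ℓ+2}, t^{ℓ+1}, t^ℓ`),
`Σ_i Θ(ρ_i)/(Δ_i(ρ_i − t)) = −Θ(t)/p(t) + C₂t² + (C₂μ₁+C₁)t + C₂(μ₁²−μ₂) + C₁μ₁ + C₀`. -/
theorem stmt17
    (F : Type*) [Field F] (ℓ : ℕ) (hl : 1 ≤ ℓ)
    (ρ : Fin ℓ → F) (hinj : Function.Injective ρ)
    (Θ : Polynomial F) (hdeg : Θ.natDegree ≤ ℓ + 2) :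
    let Δ : Fin ℓ → F := fun i => ∏ j ∈ Finset.univ.erase i, (ρ i - ρ j)
    let μ₁ : F := ∑ i, ρ i
    let μ₂ : F := ∑ S ∈ Finset.powersetCard 2 Finset.univ, ∏ i ∈ S, ρ i
    let C₂ : F := Θ.coeff (ℓ + 2)
    let C₁ : F := Θ.coeff (ℓ + 1)
    let C₀ : F := Θ.coeff ℓ
    ∀ t : F, (∀ i, t ≠ ρ i) →
      ∑ i, Θ.eval (ρ i) / (Δ i * (ρ i - t))
        = -Θ.eval t / (∏ i, (t - ρ i))
          + C₂ * t ^ 2 + (C₂ * μ₁ + C₁) * t + C₂ * (μ₁ ^ 2 - μ₂) + C₁ * μ₁ + C₀ := by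
  intro Δ μ₁ μ₂ C₂ C₁ C₀ t ht
  have hcard : #(Finset.univ : Finset (Fin ℓ)) = ℓ := Finset.card_fin ℓ
  have hne : (Finset.univ : Finset (Fin ℓ)).Nonempty := Finset.card_pos.1 (by omega)
  have hlt := degree_sub_nodal_mul_lt Finset.univ hne ρ Θ (by rwa [hcard])
  have hsum := eval_div_eval_nodal Finset.univ ρ hinj.injOn _ hlt t fun i _ => ht i
  have hp : ∏ i, (t - ρ i) ≠ 0 := Finset.prod_ne_zero_iff.2 fun i _ => sub_ne_zero.2 (ht i)
  simp only [Polynomial.eval_sub, Polynomial.eval_mul, Polynomial.eval_add, Polynomial.eval_C,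
    Polynomial.eval_pow, Polynomial.eval_X, Lagrange.eval_nodal_at_node (Finset.mem_univ _),
    zero_mul, sub_zero, Lagrange.eval_nodal, hcard, sub_div, mul_div_cancel_left₀ _ hp] at hsum
  have hneg : ∑ i, Θ.eval (ρ i) / (Δ i * (ρ i - t))
      = -∑ i, Θ.eval (ρ i) / (Δ i * (t - ρ i)) := by
    rw [← Finset.sum_neg_distrib]
    refine Finset.sum_congr rfl fun i _ => ?_
    rw [← neg_sub t (ρ i), mul_neg, div_neg]
  rw [hneg, ← hsum]
  ring
end
end

section
/- Let F be a field, V a finite-dimensional F-vector space, and A an endomorphism of V. Let ℓ ≥ 1 and let ρ₁,…,ρ_ℓ ∈ F be pairwise distinct scalars such that ρ_i·id − A is invertible for every i; set Δ_i := ∏_{j≠i}(ρ_i − ρ_j) and p(t) := ∏_{i=1}^ℓ (t − ρ_i) (so p(A) is invertible). Let Θ ∈ F[t] be a polynomial of degree ≤ ℓ+2 with coefficients C₂, C₁, C₀ of t^{ℓ+2}, t^{ℓ+1}, t^{ℓ} respectively, let μ₁, μ₂ be the first and second elementary symmetric polynomials in ρ₁,…,ρ_ℓ, and set q(t) := C₂t²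 + (C₂μ₁ + C₁)t + C₂(μ₁² − μ₂) + C₁μ₁ + C₀. Then Σ_{i=1}^ℓ (Θ(ρ_i)/Δ_i)·(ρ_i·id − A)^{−1} = −Θ(A)∘p(A)^{−1} + q(A). In particular, the left-hand side equals q(A) if and only if Θ(A) = 0. -/
open Finset Polynomial

noncomputable section

/-- The subleading coefficient of `∏ (X - ρ i)`, shifted by `X` so as to make sense for `s = ∅`. -/
theorem coeff_X_mul_prod_X_sub_C_card {ι R : Type*} [CommRing R] (s : Finset ι) (ρ : ι → R) :
    (X * ∏ i ∈ s, (X - C (ρ i))).coeff #s = -∑ i ∈ s, ρ i := by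
  classical
  nontriviality R
  induction s using Finset.induction_on with
  | empty => simp
  | insert a s ha ih =>
    have hmonic : (∏ i ∈ s, (X - C (ρ i))).coeff #s = 1 := by
      have h := (Lagrange.nodal_monic (s := s) (v := ρ)).coeff_natDegree
      rwa [Lagrange.natDegree_nodal, Lagrange.nodal_eq] at h
    rw [prod_insert ha, card_insert_of_notMem ha, sum_insert ha, coeff_X_mul, sub_mul, coeff_sub,
      coeff_C_mul, ih, hmonic]
    ring

/-- The third-highest coefficient of `∏ (X - ρ i)`, shifted by `X ^ 2` so as to make sense for
small `s`. -/
theorem coeff_X_sq_mul_prod_X_sub_C_card {ι R : Type*} [CommRing R] (s : Finset ι) (ρ : ι → R) :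
    (X * (X * ∏ i ∈ s, (X - C (ρ i)))).coeff #s = ∑ S ∈ powersetCard 2 s, ∏ i ∈ S, ρ i := by
  classical
  induction s using Finset.induction_on with
  | empty => simp [powersetCard_eq_empty.2 (show #(∅ : Finset ι) < 2 by simp)]
  | insert a s ha ih =>
    have hdisj : Disjoint (powersetCard 2 s) ((powersetCard 1 s).image (insert a)) := by
      rw [Finset.disjoint_left]
      intro S hS hS'
      obtain ⟨T, -, rfl⟩ := mem_image.1 hS'
      exact ha ((mem_powersetCard.1 hS).1 (mem_insert_self a T))
    have hsum : ∑ S ∈ powersetCard 2 (insert a s), ∏ i ∈ S, ρ i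
        = ∑ S ∈ powersetCard 2 s, ∏ i ∈ S, ρ i + ρ a * ∑ i ∈ s, ρ i := by
      rw [powersetCard_succ_insert ha, sum_union hdisj, powersetCard_one, mul_sum]
      congr 1
      rw [sum_image]
      · rw [sum_map]
        refine sum_congr rfl fun i hi => ?_
        have hai : a ∉ ({i} : Finset ι) := by
          rw [mem_singleton]; rintro rfl; exact ha hi
        exact (prod_insert hai).trans (by simp)
      · intro S hS T hT h
        have hnot : ∀ U ∈ s.map ⟨_, singleton_injective⟩, a ∉ U := by
          intro U hU haU
          obtain ⟨i, hi, rfl⟩ := mem_map.1 hU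
          exact ha (mem_singleton.1 haU ▸ hi)
        rw [← erase_insert (hnot S hS), ← erase_insert (hnot T hT)]
        exact congrArg (fun U => U.erase a) h
    rw [hsum, ← ih, prod_insert ha, card_insert_of_notMem ha, coeff_X_mul,
      show (X : R[X]) * ((X - C (ρ a)) * ∏ i ∈ s, (X - C (ρ i)))
        = X * (X * ∏ i ∈ s, (X - C (ρ i))) - C (ρ a) * (X * ∏ i ∈ s, (X - C (ρ i))) by ring,
      coeff_sub, coeff_C_mul, coeff_X_mul_prod_X_sub_C_card]
    ring

/-- The quotient of `Θ` (of degree at most `#s + 2`) by `∏ (X - ρ i)` is the explicit quadratic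
polynomial below: the remainder has degree less than `#s`. -/
theorem degree_sub_quadratic_mul_prod_X_sub_C_lt {ι R : Type*} [CommRing R] (s : Finset ι)
    (ρ : ι → R) (Θ : R[X]) (hdeg : Θ.natDegree ≤ #s + 2) {μ₁ μ₂ : R} (hμ₁ : μ₁ = ∑ i ∈ s, ρ i)
    (hμ₂ : μ₂ = ∑ S ∈ powersetCard 2 s, ∏ i ∈ S, ρ i) :
    (Θ - (C (Θ.coeff (#s + 2)) * X ^ 2
      + C (Θ.coeff (#s + 2) * μ₁ + Θ.coeff (#s + 1)) * X
      + C (Θ.coeff (#s + 2) * (μ₁ ^ 2 - μ₂) + Θ.coeff (#s + 1) * μ₁ + Θ.coeff #s))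
      * ∏ i ∈ s, (X - C (ρ i))).degree < (#s : WithBot ℕ) := by
  nontriviality R
  have h₁ := coeff_X_mul_prod_X_sub_C_card s ρ
  have h₂ := coeff_X_sq_mul_prod_X_sub_C_card s ρ
  have hnat : (∏ i ∈ s, (X - C (ρ i))).natDegree = #s := Lagrange.natDegree_nodal
  have h₀ : (∏ i ∈ s, (X - C (ρ i))).coeff #s = 1 := by
    have h := (Lagrange.nodal_monic (s := s) (v := ρ)).coeff_natDegree
    rwa [Lagrange.natDegree_nodal, Lagrange.nodal_eq] at h
  rw [← hμ₁] at h₁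
  rw [← hμ₂] at h₂
  generalize ∏ i ∈ s, (X - C (ρ i)) = P at h₀ h₁ h₂ hnat ⊢
  have hzero : ∀ k, #s < k → P.coeff k = 0 := fun k hk =>
    coeff_eq_zero_of_natDegree_lt (hnat.trans_lt hk)
  rw [degree_lt_iff_coeff_zero]
  intro m hm
  rw [show ∀ a b c : R, (C a * X ^ 2 + C b * X + C c) * P
      = C a * (X * (X * P)) + C b * (X * P) + C c * P from fun a b c => by ring]
  simp only [coeff_sub, coeff_add, coeff_C_mul]
  obtain ⟨k, rfl⟩ := Nat.exists_eq_add_of_le hm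
  match k with
  | 0 =>
    simp only [add_zero, h₀, h₁, h₂]
    ring
  | 1 =>
    rw [coeff_X_mul, coeff_X_mul, h₁, h₀, hzero _ (by lia)]
    ring
  | 2 =>
    rw [show #s + 2 = #s + 1 + 1 from rfl, coeff_X_mul, coeff_X_mul, coeff_X_mul, h₀,
      hzero (#s + 1) (by lia), hzero (#s + 1 + 1) (by lia)]
    ring
  | k + 3 =>
    rw [show #s + (k + 3) = #s + k + 1 + 1 + 1 by ring, coeff_X_mul, coeff_X_mul, coeff_X_mul,
      hzero (#s + k + 1) (by lia), hzero (#s + k + 1 + 1) (by lia),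
      hzero (#s + k + 1 + 1 + 1) (by lia), coeff_eq_zero_of_natDegree_lt (by lia)]
    ring

/-- Lagrange interpolation with unnormalized basis polynomials. -/
theorem interpolate_eq_sum_prod_erase {ι F : Type*} [Field F] [DecidableEq ι] (s : Finset ι)
    (ρ r : ι → F) :
    Lagrange.interpolate s ρ r = ∑ i ∈ s,
      C (r i / ∏ j ∈ s.erase i, (ρ i - ρ j)) * ∏ j ∈ s.erase i, (X - C (ρ j)) := by
  rw [Lagrange.interpolate_apply]
  refine sum_congr rfl fun i _ => ?_
  simp only [Lagrange.basis, Lagrange.basisDivisor, prod_mul_distrib, div_eq_mul_inv, C_mul,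
    ← Finset.prod_inv_distrib, map_prod, mul_assoc]

/-- For an endomorphism `A` with `ρ_i·id − A` invertible and pairwise distinct `ρ_i`,
`Σ_i (Θ(ρ_i)/Δ_i)·(ρ_i·id − A)⁻¹ = −Θ(A)∘p(A)⁻¹ + q(A)`; in particular the left-hand
side equals `q(A)` iff `Θ(A) = 0`. -/
theorem stmt18
    (F : Type*) [Field F]
    (V : Type*) [AddCommGroup V] [Module F V] [FiniteDimensional F V]
    (A : Module.End F V)
    (ℓ : ℕ) (hl : 1 ≤ ℓ)
    (ρ : Fin ℓ → F) (hinj : Function.Injective ρ)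
    (hinv : ∀ i, IsUnit (ρ i • (1 : Module.End F V) - A))
    (Θ : Polynomial F) (hdeg : Θ.natDegree ≤ ℓ + 2) :
    let Δ : Fin ℓ → F := fun i => ∏ j ∈ Finset.univ.erase i, (ρ i - ρ j)
    let μ₁ : F := ∑ i, ρ i
    let μ₂ : F := ∑ S ∈ Finset.powersetCard 2 Finset.univ, ∏ i ∈ S, ρ i
    let C₂ : F := Θ.coeff (ℓ + 2)
    let C₁ : F := Θ.coeff (ℓ + 1)
    let C₀ : F := Θ.coeff ℓ
    let qA : Module.End F V :=
      C₂ • A ^ 2 + (C₂ * μ₁ + C₁) • A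
        + (C₂ * (μ₁ ^ 2 - μ₂) + C₁ * μ₁ + C₀) • (1 : Module.End F V)
    let p : Polynomial F := ∏ i, (Polynomial.X - Polynomial.C (ρ i))
    (∑ i, (Θ.eval (ρ i) / Δ i) • Ring.inverse (ρ i • (1 : Module.End F V) - A)
      = -(Polynomial.aeval A Θ) * Ring.inverse (Polynomial.aeval A p) + qA) ∧
    ((∑ i, (Θ.eval (ρ i) / Δ i) • Ring.inverse (ρ i • (1 : Module.End F V) - A) = qA)
      ↔ Polynomial.aeval A Θ = 0) := by
  intro Δ μ₁ μ₂ C₂ C₁ C₀ qA p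
  have hfactor (i : Fin ℓ) : (ρ i • (1 : Module.End F V) - A)
      * aeval A (∏ j ∈ univ.erase i, (X - C (ρ j))) = -aeval A p := by
    have hlin : ρ i • (1 : Module.End F V) - A = aeval A (-(X - C (ρ i))) := by
      simp [Algebra.algebraMap_eq_smul_one]
    rw [hlin, ← map_mul, neg_mul, mul_prod_erase univ (fun j => X - C (ρ j)) (mem_univ i), map_neg]
  have hp : IsUnit (aeval A p) := by
    have hprod : ∀ s : Finset (Fin ℓ), IsUnit (aeval A (∏ i ∈ s, (X - C (ρ i)))) := by
      intro s
      induction s using Finset.induction_on with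
      | empty => simp
      | insert a s ha ih =>
        rw [prod_insert ha, map_mul]
        refine IsUnit.mul ?_ ih
        simpa [Algebra.algebraMap_eq_smul_one] using (hinv a).neg
    exact hprod univ
  have hinverse (i : Fin ℓ) : Ring.inverse (ρ i • (1 : Module.End F V) - A)
      = -(aeval A (∏ j ∈ univ.erase i, (X - C (ρ j)))) * Ring.inverse (aeval A p) := by
    refine (hinv i).mul_left_cancel ?_
    rw [Ring.mul_inverse_cancel _ (hinv i), ← mul_assoc, mul_neg, hfactor, neg_neg,
      Ring.mul_inverse_cancel _ hp]
  set q : F[X] := C C₂ * X ^ 2 + C (C₂ * μ₁ + C₁) * X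
    + C (C₂ * (μ₁ ^ 2 - μ₂) + C₁ * μ₁ + C₀) with hq
  have hqA : aeval A q = qA := by
    simp only [hq, qA, map_add (aeval A), map_mul (aeval A), map_pow (aeval A), aeval_C, aeval_X,
      Algebra.algebraMap_eq_smul_one, smul_mul_assoc, one_mul]
  have hdivision : Θ - q * p = ∑ i, C (Θ.eval (ρ i) / Δ i) * ∏ j ∈ univ.erase i, (X - C (ρ j)) := by
    rw [← interpolate_eq_sum_prod_erase univ ρ fun i => Θ.eval (ρ i)]
    refine Lagrange.eq_interpolate_of_eval_eq _ hinj.injOn ?_ fun i _ => ?_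
    · have h := degree_sub_quadratic_mul_prod_X_sub_C_lt univ ρ Θ (by rwa [card_fin])
        (show μ₁ = _ from rfl) (show μ₂ = _ from rfl)
      rw [card_fin] at h ⊢
      exact h
    · have hpi : p.eval (ρ i) = 0 := Lagrange.eval_nodal_at_node (mem_univ i)
      simp [hpi]
  have hmain : ∑ i, (Θ.eval (ρ i) / Δ i) • Ring.inverse (ρ i • (1 : Module.End F V) - A)
      = -(aeval A Θ) * Ring.inverse (aeval A p) + qA := by
    have hsum := congrArg (aeval A) hdivision
    simp only [map_sub, map_mul (aeval A), map_sum, aeval_C, Algebra.algebraMap_eq_smul_one,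
      smul_mul_assoc, one_mul, hqA] at hsum
    simp only [hinverse, neg_mul, smul_neg, sum_neg_distrib, ← smul_mul_assoc, ← sum_mul]
    rw [← hsum, sub_mul, mul_assoc, Ring.mul_inverse_cancel _ hp, mul_one]
    abel
  refine ⟨hmain, ?_⟩
  rw [hmain, add_eq_right, neg_mul, neg_eq_zero, hp.ringInverse.mul_left_eq_zero]
end
end
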